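/- arXiv:2204.00724 — 7 statements merged into one kernel-verified Lean document; each statement's English description precedes it below -/
import Mathlib

section
/- For all integers a ≥ 1 and b ≥ 1 there exists an injective group homomorphism from the symplectic group Sp(2a, F) over the field F with 2^b elements into the symplectic group Sp(2ab, F₂) over the field with 2 elements. -/
noncomputable section

open Matrix in
/-- Relabelling the index type of a symplectic group. -/
def symplecticReindex {l m R : Type*} [Fintype l] [DecidableEq l] [Fintype m] [DecidableEq m]
    [CommRing R] (ε : l ≃ m) : symplecticGroup l R →* symplecticGroup m R :=
  ((reindexRingEquiv R (ε.sumCongr ε)).toRingHom.toMonoidHom.comp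
    (symplecticGroup l R).subtype).codRestrict _ fun A => by
      have hA := A.2
      rw [SymplecticGroup.mem_iff] at hA ⊢
      have hJ : J m R = reindexRingEquiv R (ε.sumCongr ε) (J l R) := by
        ext i j
        cases i <;> cases j <;> simp [J, one_apply]
      have hT : (reindexRingEquiv R (ε.sumCongr ε) (A : Matrix (l ⊕ l) (l ⊕ l) R))ᵀ =
          reindexRingEquiv R (ε.sumCongr ε) (A : Matrix (l ⊕ l) (l ⊕ l) R)ᵀ := rfl
      change reindexRingEquiv R _ (A : Matrix (l ⊕ l) (l ⊕ l) R) * J m R *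
        (reindexRingEquiv R _ (A : Matrix (l ⊕ l) (l ⊕ l) R))ᵀ = J m R
      rw [hT, hJ, ← map_mul, ← map_mul, hA]

theorem symplecticReindex_injective {l m R : Type*} [Fintype l] [DecidableEq l] [Fintype m]
    [DecidableEq m] [CommRing R] (ε : l ≃ m) :
    Function.Injective (symplecticReindex (R := R) ε) := fun _ _ h =>
  Subtype.ext ((Matrix.reindexRingEquiv R (ε.sumCongr ε)).injective (congrArg Subtype.val h))

section RestrictScalars

open Matrix Module
open scoped Kronecker

variable {l n R S : Type*} [Fintype l] [DecidableEq l] [Fintype n] [DecidableEq n]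
  [CommRing R] [CommRing S] [Algebra R S]

theorem transpose_traceMatrix {ι : Type*} (v : ι → S) :
    (Algebra.traceMatrix R v)ᵀ = Algebra.traceMatrix R v := by
  ext i j
  simp [Algebra.traceMatrix_apply, Algebra.traceForm_apply, mul_comm]

theorem traceMatrix_mul_leftMulMatrix (e : Basis n R S) (x : S) :
    Algebra.traceMatrix R e * Algebra.leftMulMatrix e x =
      (Algebra.leftMulMatrix e x)ᵀ * Algebra.traceMatrix R e := by
  have key (i j : n) : (Algebra.traceMatrix R e * Algebra.leftMulMatrix e x) i j =
      Algebra.trace R S (e i * (x * e j)) := by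
    conv_rhs => rw [← e.sum_repr (x * e j), Finset.mul_sum, map_sum]
    simp [mul_apply, Algebra.traceMatrix_apply, Algebra.traceForm_apply,
      Algebra.leftMulMatrix_eq_repr_mul, mul_comm]
  have htr : (Algebra.leftMulMatrix e x)ᵀ * Algebra.traceMatrix R e =
      (Algebra.traceMatrix R e * Algebra.leftMulMatrix e x)ᵀ := by
    rw [transpose_mul, transpose_traceMatrix]
  ext i j
  rw [htr, transpose_apply, key, key]
  congr 1
  ring

/-- Restriction of scalars on square matrices of even size, keeping the two halves apart. -/
def restrictScalarsMatrix (e : Basis n R S) :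
    Matrix (l ⊕ l) (l ⊕ l) S →+* Matrix (l × n ⊕ l × n) (l × n ⊕ l × n) R :=
  (reindexRingEquiv R (Equiv.sumProdDistrib l l n)).toRingHom.comp <|
    (compRingEquiv (l ⊕ l) n R).toRingHom.comp (Algebra.leftMulMatrix e).toRingHom.mapMatrix

theorem restrictScalarsMatrix_apply (e : Basis n R S) (A : Matrix (l ⊕ l) (l ⊕ l) S)
    (i j : l × n ⊕ l × n) :
    restrictScalarsMatrix e A i j =
      Algebra.leftMulMatrix e
        (A ((Equiv.sumProdDistrib l l n).symm i).1 ((Equiv.sumProdDistrib l l n).symm j).1)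
        ((Equiv.sumProdDistrib l l n).symm i).2 ((Equiv.sumProdDistrib l l n).symm j).2 :=
  rfl

theorem restrictScalarsMatrix_injective (e : Basis n R S) :
    Function.Injective (restrictScalarsMatrix (l := l) e) := by
  intro A B h
  ext i j
  apply Algebra.leftMulMatrix_injective e
  ext p q
  simpa [restrictScalarsMatrix_apply] using
    congrFun (congrFun h (Equiv.sumProdDistrib l l n (i, p))) (Equiv.sumProdDistrib l l n (j, q))

theorem restrictScalarsMatrix_J (e : Basis n R S) :
    restrictScalarsMatrix e (J l S) = J (l × n) R := by
  ext (⟨i, p⟩ | ⟨i, p⟩) (⟨j, q⟩ | ⟨j, q⟩) <;>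
  by_cases h : i = j <;>
    simp [restrictScalarsMatrix_apply, J, one_apply, h]

/-- The block diagonal matrix all of whose blocks are `M`. -/
abbrev blockScalar (l : Type*) [DecidableEq l] (M : Matrix n n R) :
    Matrix (l × n ⊕ l × n) (l × n ⊕ l × n) R :=
  fromBlocks ((1 : Matrix l l R) ⊗ₖ M) 0 0 ((1 : Matrix l l R) ⊗ₖ M)

theorem blockScalar_traceMatrix_mul (e : Basis n R S) (A : Matrix (l ⊕ l) (l ⊕ l) S) :
    blockScalar l (Algebra.traceMatrix R e) * restrictScalarsMatrix e Aᵀ =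
      (restrictScalarsMatrix e A)ᵀ * blockScalar l (Algebra.traceMatrix R e) := by
  ext (⟨i, p⟩ | ⟨i, p⟩) (⟨j, q⟩ | ⟨j, q⟩) <;>
  simp only [mul_apply, Fintype.sum_sum_type, Fintype.sum_prod_type, fromBlocks_apply₁₁,
    fromBlocks_apply₁₂, fromBlocks_apply₂₁, fromBlocks_apply₂₂, kroneckerMap_apply, one_apply,
    Matrix.zero_apply, zero_mul, mul_zero, Finset.sum_const_zero, add_zero, zero_add, ite_mul, mul_ite,
    one_mul, Finset.sum_ite_irrel, Finset.sum_ite_eq, Finset.sum_ite_eq', Finset.mem_univ,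
    if_true, transpose_apply, restrictScalarsMatrix_apply,
    Equiv.sumProdDistrib_symm_apply_left, Equiv.sumProdDistrib_symm_apply_right]
  · exact congrFun (congrFun (traceMatrix_mul_leftMulMatrix e (A (.inl j) (.inl i))) p) q
  · exact congrFun (congrFun (traceMatrix_mul_leftMulMatrix e (A (.inr j) (.inl i))) p) q
  · exact congrFun (congrFun (traceMatrix_mul_leftMulMatrix e (A (.inl j) (.inr i))) p) q
  · exact congrFun (congrFun (traceMatrix_mul_leftMulMatrix e (A (.inr j) (.inr i))) p) q

/-- If the trace form is nondegenerate, restriction of scalars followed by a change of basis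
embeds the symplectic group over `S` into a symplectic group over `R`. -/
theorem exists_injective_symplecticGroup_restrictScalars (e : Basis n R S)
    (hT : IsUnit (Algebra.traceMatrix R e).det) :
    ∃ f : symplecticGroup l S →* symplecticGroup (l × n) R, Function.Injective f := by
  set T := Algebra.traceMatrix R e
  have hsymm : Tᵀ = T := transpose_traceMatrix e
  set t := (1 : Matrix l l R) ⊗ₖ T with ht
  set s := (1 : Matrix l l R) ⊗ₖ T⁻¹ with hs
  have hts : t * s = 1 := by
    rw [ht, hs, ← mul_kronecker_mul, mul_nonsing_inv _ hT, one_mul, one_kronecker_one]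
  have hst : s * t = 1 := mul_eq_one_comm.mp hts
  have htt : tᵀ = t := by
    rw [ht, ← kroneckerMap_transpose, hsymm, transpose_one]
  have hss : sᵀ = s := by
    rw [hs, ← kroneckerMap_transpose, transpose_nonsing_inv, hsymm, transpose_one]
  let D := blockScalar l T
  let E := blockScalar l T⁻¹
  let P : Matrix (l × n ⊕ l × n) (l × n ⊕ l × n) R := fromBlocks 1 0 0 t
  let Q : Matrix (l × n ⊕ l × n) (l × n ⊕ l × n) R := fromBlocks 1 0 0 s
  have hDE : D * E = 1 := by
    simp [D, E, fromBlocks_multiply, ← ht, ← hs, hts]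
  have hED : E * D = 1 := mul_eq_one_comm.mp hDE
  have hPQ : P * Q = 1 := by simp [P, Q, fromBlocks_multiply, hts]
  have hQP : Q * P = 1 := mul_eq_one_comm.mp hPQ
  have hQJ : Q * J (l × n) R * Qᵀ = J (l × n) R * E := by
    simp [Q, E, J, fromBlocks_multiply, fromBlocks_transpose, ← hs, hss]
  have hPJ : P * (J (l × n) R * E) * Pᵀ = J (l × n) R := by
    simp [P, E, J, fromBlocks_multiply, fromBlocks_transpose, ← hs, htt, hts, hst]
  have hφ (A : Matrix (l ⊕ l) (l ⊕ l) S) :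
      E * (restrictScalarsMatrix e A)ᵀ = restrictScalarsMatrix e Aᵀ * E := by
    have h : D * restrictScalarsMatrix e Aᵀ = (restrictScalarsMatrix e A)ᵀ * D :=
      blockScalar_traceMatrix_mul e A
    calc E * (restrictScalarsMatrix e A)ᵀ
        = E * ((restrictScalarsMatrix e A)ᵀ * D) * E := by
          rw [Matrix.mul_assoc, Matrix.mul_assoc, hDE, Matrix.mul_one]
      _ = restrictScalarsMatrix e Aᵀ * E := by
          rw [← h, ← Matrix.mul_assoc, hED, Matrix.one_mul]
  let g : Matrix (l ⊕ l) (l ⊕ l) S →* Matrix (l × n ⊕ l × n) (l × n ⊕ l × n) R :=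
    { toFun := fun A => P * restrictScalarsMatrix e A * Q
      map_one' := by rw [map_one, Matrix.mul_one, hPQ]
      map_mul' := fun A B => by
        rw [map_mul]
        calc P * (restrictScalarsMatrix e A * restrictScalarsMatrix e B) * Q
            = P * restrictScalarsMatrix e A * 1 * restrictScalarsMatrix e B * Q := by
              simp only [Matrix.mul_one, Matrix.mul_assoc]
          _ = _ := by rw [← hQP]; simp only [Matrix.mul_assoc] }
  have hg : ∀ A, Q * g A * P = restrictScalarsMatrix e A := fun A => by
    change Q * (P * restrictScalarsMatrix e A * Q) * P = _
    rw [← Matrix.mul_assoc, ← Matrix.mul_assoc, hQP, Matrix.one_mul, Matrix.mul_assoc, hQP,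
      Matrix.mul_one]
  refine ⟨(g.comp (symplecticGroup l S).subtype).codRestrict _ fun A => ?_, fun A B h => ?_⟩
  · have hA := SymplecticGroup.mem_iff.mp A.2
    rw [SymplecticGroup.mem_iff]
    obtain ⟨X, hX⟩ := A
    change P * restrictScalarsMatrix e X * Q * J (l × n) R *
      (P * restrictScalarsMatrix e X * Q)ᵀ = J (l × n) R
    calc P * restrictScalarsMatrix e X * Q * J (l × n) R * (P * restrictScalarsMatrix e X * Q)ᵀ
        = P * restrictScalarsMatrix e X * (Q * J (l × n) R * Qᵀ) *
            (restrictScalarsMatrix e X)ᵀ * Pᵀ := by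
          simp only [transpose_mul, Matrix.mul_assoc]
      _ = P * restrictScalarsMatrix e X * J (l × n) R *
            (E * (restrictScalarsMatrix e X)ᵀ) * Pᵀ := by
          rw [hQJ]; simp only [Matrix.mul_assoc]
      _ = P * (restrictScalarsMatrix e (X * J l S * Xᵀ) * E) * Pᵀ := by
          rw [hφ, map_mul, map_mul, restrictScalarsMatrix_J]; simp only [Matrix.mul_assoc]
      _ = J (l × n) R := by rw [hA, restrictScalarsMatrix_J, hPJ]
  · have h' : g A = g B := congrArg Subtype.val h
    exact Subtype.ext (restrictScalarsMatrix_injective e (by rw [← hg, ← hg, h']))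

end RestrictScalars

theorem symplectic_embedding (a b : ℕ) (ha : 1 ≤ a) (hb : 1 ≤ b) :
    ∃ f : Matrix.symplecticGroup (Fin a) (GaloisField 2 b) →*
          Matrix.symplecticGroup (Fin (a * b)) (ZMod 2),
      Function.Injective f := by
  let e : Module.Basis (Fin b) (ZMod 2) (GaloisField 2 b) :=
    Module.finBasisOfFinrankEq _ _ (GaloisField.finrank 2 (by omega))
  obtain ⟨f, hf⟩ := exists_injective_symplecticGroup_restrictScalars (l := Fin a) e
    (Algebra.discr_isUnit_of_basis _ e)
  exact ⟨(symplecticReindex finProdFinEquiv).comp f,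
    (symplecticReindex_injective finProdFinEquiv).comp hf⟩
end
end

section
/- Let m ≥ 2 and let S = Sp(2m, F₂) act on its natural module N = F₂^(2m). Then there exists an F₂[S]-module U together with a one-dimensional submodule U₀ on which S acts trivially such that U/U₀ is isomorphic to N as an F₂[S]-module and U is indecomposable (not the direct sum of two proper nonzero S-submodules); moreover, any two F₂[S]-modules with these properties are isomorphic as F₂[S]-modules. -/
open Module

noncomputable section

/-- An `F₂[Sp(2m,2)]`-module `U` with a one-dimensional trivial submodule `U₀` such
that `U/U₀` is the natural module `F₂^(2m)` and `U` is indecomposable. -/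
structure NaturalExtension (m : ℕ) where
  U : Type
  [acg : AddCommGroup U]
  [mod : Module (ZMod 2) U]
  ρ : Matrix.symplecticGroup (Fin m) (ZMod 2) →* (U ≃ₗ[ZMod 2] U)
  U₀ : Submodule (ZMod 2) U
  /-- `U₀` is one-dimensional -/
  hdim : finrank (ZMod 2) U₀ = 1
  /-- `S` acts trivially on `U₀` -/
  htriv : ∀ (g : Matrix.symplecticGroup (Fin m) (ZMod 2)), ∀ u ∈ U₀, ρ g u = u
  /-- `U/U₀` is isomorphic to the natural module `F₂^(2m)`, `S`-equivariantly -/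
  hquot : ∃ φ : (U ⧸ U₀) ≃ₗ[ZMod 2] ((Fin m ⊕ Fin m) → ZMod 2),
    ∀ (g : Matrix.symplecticGroup (Fin m) (ZMod 2)) (u : U),
      φ (Submodule.Quotient.mk (ρ g u)) =
        Matrix.mulVec (g : Matrix (Fin m ⊕ Fin m) (Fin m ⊕ Fin m) (ZMod 2))
          (φ (Submodule.Quotient.mk u))
  /-- `U` is indecomposable -/
  hindec : ∀ W₁ W₂ : Submodule (ZMod 2) U,
    (∀ g : Matrix.symplecticGroup (Fin m) (ZMod 2),
      W₁.map (ρ g : U →ₗ[ZMod 2] U) ≤ W₁) →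
    (∀ g : Matrix.symplecticGroup (Fin m) (ZMod 2),
      W₂.map (ρ g : U →ₗ[ZMod 2] U) ≤ W₂) →
    IsCompl W₁ W₂ → W₁ = ⊥ ∨ W₂ = ⊥

attribute [instance] NaturalExtension.acg NaturalExtension.mod

/-- The vectors of the natural module `F₂^(2m)`. -/
abbrev SympVec (m : ℕ) : Type := (Fin m ⊕ Fin m) → ZMod 2

/-- The symplectic group `Sp(2m, F₂)`. -/
abbrev SpTwo (m : ℕ) : Type := Matrix.symplecticGroup (Fin m) (ZMod 2)

theorem ZMod.eq_zero_or_eq_one_of_two (a : ZMod 2) : a = 0 ∨ a = 1 := by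
  revert a; decide

section Form

variable {m : ℕ}

/-- The standard alternating form on `F₂^(2m)`. -/
def sympForm (m : ℕ) : LinearMap.BilinForm (ZMod 2) (SympVec m) :=
  Matrix.toBilin' (Matrix.J (Fin m) (ZMod 2))

theorem sympForm_apply (v w : SympVec m) :
    sympForm m v w = ∑ i, (v (.inl i) * w (.inr i) + v (.inr i) * w (.inl i)) := by
  simp [sympForm, Matrix.toBilin'_apply', Matrix.J, dotProduct, Matrix.mulVec,
    Matrix.fromBlocks, Matrix.one_apply, Finset.sum_add_distrib, CharTwo.neg_eq]

theorem sympForm_comm (v w : SympVec m) : sympForm m v w = sympForm m w v := by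
  simp only [sympForm_apply]
  exact Finset.sum_congr rfl fun i _ => by ring

@[simp]
theorem sympForm_self (v : SympVec m) : sympForm m v v = 0 := by
  rw [sympForm_apply]
  refine Finset.sum_eq_zero fun i _ => ?_
  rw [mul_comm, CharTwo.add_self_eq_zero]

theorem exists_sympForm_eq_one {u : SympVec m} (hu : u ≠ 0) : ∃ v, sympForm m v u = 1 := by
  obtain ⟨i, hi⟩ := Function.ne_iff.mp hu
  have hi : u i = 1 := (ZMod.eq_zero_or_eq_one_of_two _).resolve_left hi
  rcases i with i | i
  · exact ⟨Pi.single (.inr i) 1, by simp [sympForm_apply, Pi.single_apply, hi]⟩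
  · exact ⟨Pi.single (.inl i) 1, by simp [sympForm_apply, Pi.single_apply, hi]⟩

theorem sympForm_mulVec (g : SpTwo m) (v w : SympVec m) :
    sympForm m (g.1.mulVec v) (g.1.mulVec w) = sympForm m v w := by
  have h := SymplecticGroup.mem_iff'.mp g.2
  simp only [sympForm, Matrix.toBilin'_apply']
  conv_rhs => rw [← h]
  rw [← Matrix.mulVec_mulVec, ← Matrix.mulVec_mulVec, Matrix.dotProduct_mulVec v,
    Matrix.vecMul_transpose]

theorem mem_symplecticGroup_of_sympForm {A : Matrix (Fin m ⊕ Fin m) (Fin m ⊕ Fin m) (ZMod 2)}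
    (h : ∀ v w, sympForm m (A.mulVec v) (A.mulVec w) = sympForm m v w) :
    A ∈ Matrix.symplecticGroup (Fin m) (ZMod 2) := by
  rw [SymplecticGroup.mem_iff']
  apply Matrix.toBilin'.injective
  refine LinearMap.ext₂ fun v w => ?_
  rw [← sympForm, ← h v w]
  simp only [sympForm, Matrix.toBilin'_apply']
  rw [← Matrix.mulVec_mulVec, ← Matrix.mulVec_mulVec, Matrix.dotProduct_mulVec v,
    Matrix.vecMul_transpose]

theorem exists_sympForm_eq_zero_eq_one {u w : SympVec m} (hw : w ≠ 0) (huw : u ≠ w) :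
    ∃ v, sympForm m v u = 0 ∧ sympForm m v w = 1 := by
  obtain ⟨x, hx⟩ := exists_sympForm_eq_one hw
  obtain ⟨y, hy⟩ := exists_sympForm_eq_one (u := u + w)
    (by rwa [Ne, add_eq_zero_iff_eq_neg, ZModModule.neg_eq_self])
  rw [map_add] at hy
  rcases ZMod.eq_zero_or_eq_one_of_two (sympForm m x u) with h | h
  · exact ⟨x, h, hx⟩
  rcases ZMod.eq_zero_or_eq_one_of_two (sympForm m y u) with h' | h'
  · exact ⟨y, h', by simpa [h'] using hy⟩
  · refine ⟨x + y, ?_, ?_⟩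
    · simp [h, h', CharTwo.add_self_eq_zero]
    · simpa [hx, h'] using hy

/-- If two vectors are each separated from a subset of vectors closed under addition, a single
member of that subset separates both. -/
theorem exists_sympForm_eq_one_eq_one {W : AddSubmonoid (SympVec m)} {u w : SympVec m}
    (hu : ∃ v ∈ W, sympForm m v u = 1) (hw : ∃ v ∈ W, sympForm m v w = 1) :
    ∃ v ∈ W, sympForm m v u = 1 ∧ sympForm m v w = 1 := by
  obtain ⟨x, hxW, hx⟩ := hu
  obtain ⟨y, hyW, hy⟩ := hw
  rcases ZMod.eq_zero_or_eq_one_of_two (sympForm m x w) with h | h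
  · rcases ZMod.eq_zero_or_eq_one_of_two (sympForm m y u) with h' | h'
    · exact ⟨x + y, W.add_mem hxW hyW, by simp [hx, h'], by simp [hy, h]⟩
    · exact ⟨y, hyW, h', hy⟩
  · exact ⟨x, hxW, hx, h⟩

theorem exists_sympForm_eq_one_both {u w : SympVec m} (hu : u ≠ 0) (hw : w ≠ 0) :
    ∃ v, sympForm m v u = 1 ∧ sympForm m v w = 1 := by
  obtain ⟨v, -, h⟩ := exists_sympForm_eq_one_eq_one (W := ⊤) (u := u) (w := w)
    (by simpa using exists_sympForm_eq_one hu) (by simpa using exists_sympForm_eq_one hw)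
  exact ⟨v, h⟩

theorem exists_ne_zero_sympForm_eq_zero (hm : 2 ≤ m) (a b : SympVec m) :
    ∃ z ≠ 0, sympForm m a z = 0 ∧ sympForm m b z = 0 := by
  have h := LinearMap.ker_ne_bot_of_finrank_lt (f := (sympForm m a).prod (sympForm m b))
    (by simp [Module.finrank_prod]; omega)
  obtain ⟨z, hz, hz0⟩ := Submodule.exists_mem_ne_zero_of_ne_bot h
  have hz' : sympForm m a z = 0 ∧ sympForm m b z = 0 := by simpa using hz
  exact ⟨z, hz0, hz'⟩

theorem one_add_vecMulVec_mulVec (u v : SympVec m) :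
    (1 + Matrix.vecMulVec u ((Matrix.J (Fin m) (ZMod 2)).mulVec u)).mulVec v =
      v + sympForm m v u • u := by
  rw [Matrix.add_mulVec, Matrix.one_mulVec, Matrix.vecMulVec_mulVec, op_smul_eq_smul,
    dotProduct_comm, sympForm, Matrix.toBilin'_apply']

/-- The symplectic transvection `v ↦ v + B(v, u) u`. -/
def transvec (u : SympVec m) : SpTwo m :=
  ⟨1 + Matrix.vecMulVec u ((Matrix.J (Fin m) (ZMod 2)).mulVec u), by
    refine mem_symplecticGroup_of_sympForm fun v w => ?_
    simp only [one_add_vecMulVec_mulVec, map_add, map_smul, LinearMap.add_apply,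
      LinearMap.smul_apply, smul_eq_mul, sympForm_self, sympForm_comm u w]
    linear_combination CharTwo.add_self_eq_zero (sympForm m v u * sympForm m w u)⟩

theorem transvec_mulVec (u v : SympVec m) :
    (transvec u).1.mulVec v = v + sympForm m v u • u :=
  one_add_vecMulVec_mulVec u v

theorem SpTwo.ext_mulVec {g h : SpTwo m} (H : ∀ v, g.1.mulVec v = h.1.mulVec v) : g = h :=
  Subtype.ext (Matrix.mulVec_injective (funext H))

theorem SpTwo.mul_mulVec (g h : SpTwo m) (v : SympVec m) :
    (g * h).1.mulVec v = g.1.mulVec (h.1.mulVec v) :=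
  (Matrix.mulVec_mulVec v g.1 h.1).symm

theorem transvec_zero : transvec (0 : SympVec m) = 1 :=
  SpTwo.ext_mulVec fun v => by simp [transvec_mulVec]

theorem transvec_mul_self (u : SympVec m) : transvec u * transvec u = 1 :=
  SpTwo.ext_mulVec fun v => by
    rw [SpTwo.mul_mulVec]
    simp [transvec_mulVec, add_assoc, ZModModule.add_self]

theorem mul_transvec (g : SpTwo m) (u : SympVec m) :
    g * transvec u = transvec (g.1.mulVec u) * g :=
  SpTwo.ext_mulVec fun v => by
    simp only [SpTwo.mul_mulVec, transvec_mulVec, sympForm_mulVec, Matrix.mulVec_add,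
      Matrix.mulVec_smul]

end Form

section Cocycle

variable {m : ℕ}

/-- A 1-cocycle of `Sp(2m, F₂)` with values in the dual of the natural module. -/
def IsDualCocycle (c : SpTwo m → Dual (ZMod 2) (SympVec m)) : Prop :=
  ∀ g h v, c (g * h) v = c g (h.1.mulVec v) + c h v

/-- A 1-coboundary of `Sp(2m, F₂)` with values in the dual of the natural module. -/
def IsDualCoboundary (c : SpTwo m → Dual (ZMod 2) (SympVec m)) : Prop :=
  ∃ l : Dual (ZMod 2) (SympVec m), ∀ g v, c g v = l (g.1.mulVec v) + l v

/-- The failure of additivity of `f`. -/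
def additivityDefect (f : SympVec m → ZMod 2) (a x : SympVec m) : ZMod 2 :=
  f (a + x) + f a + f x

/-- Two vectors span a totally isotropic plane. -/
def IsIsotropicPair (a x : SympVec m) : Prop :=
  a ≠ 0 ∧ x ≠ 0 ∧ a ≠ x ∧ sympForm m a x = 0

theorem IsIsotropicPair.symm {a x : SympVec m} (h : IsIsotropicPair a x) :
    IsIsotropicPair x a :=
  ⟨h.2.1, h.1, h.2.2.1.symm, by rw [sympForm_comm, h.2.2.2]⟩

theorem additivityDefect_comm (f : SympVec m → ZMod 2) (a x : SympVec m) :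
    additivityDefect f a x = additivityDefect f x a := by
  rw [additivityDefect, additivityDefect, add_comm a x]
  ring

theorem additivityDefect_eq_of_sympForm_eq_one {f : SympVec m → ZMod 2}
    (hf : ∀ u w, sympForm m u w = 1 → f (u + w) = f u + f w) {a w x : SympVec m}
    (haw : sympForm m a w = 0) (hax : sympForm m a x = 0) (hwx : sympForm m w x = 1) :
    additivityDefect f a w = additivityDefect f a x := by
  have h₁ := hf (a + w) x (by simp [hax, hwx])
  have h₂ := hf w (a + x) (by rw [map_add, sympForm_comm w a, haw, hwx, zero_add])
  rw [show w + (a + x) = a + w + x by abel] at h₂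
  rw [additivityDefect, additivityDefect]
  linear_combination h₂ - h₁ + CharTwo.add_self_eq_zero (f w) - CharTwo.add_self_eq_zero (f x)

theorem additivityDefect_right_eq {f : SympVec m → ZMod 2}
    (hf : ∀ u w, sympForm m u w = 1 → f (u + w) = f u + f w) {a w x : SympVec m}
    (haw : IsIsotropicPair a w) (hax : IsIsotropicPair a x) :
    additivityDefect f a w = additivityDefect f a x := by
  obtain ⟨y, hya, hyw, hyx⟩ := exists_sympForm_eq_one_eq_one
    (W := (LinearMap.ker (sympForm m a)).toAddSubmonoid) (u := w) (w := x)
    (by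
      obtain ⟨v, hv, hv'⟩ := exists_sympForm_eq_zero_eq_one haw.2.1 haw.2.2.1
      exact ⟨v, by simpa [sympForm_comm] using hv, hv'⟩)
    (by
      obtain ⟨v, hv, hv'⟩ := exists_sympForm_eq_zero_eq_one hax.2.1 hax.2.2.1
      exact ⟨v, by simpa [sympForm_comm] using hv, hv'⟩)
  have hay : sympForm m a y = 0 := by simpa using hya
  rw [additivityDefect_eq_of_sympForm_eq_one hf haw.2.2.2 hay (by rwa [sympForm_comm]),
    additivityDefect_eq_of_sympForm_eq_one hf hay hax.2.2.2 hyx]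

/-- A function additive on hyperbolic pairs has the same additivity defect on all isotropic
pairs. -/
theorem additivityDefect_eq (hm : 2 ≤ m) {f : SympVec m → ZMod 2}
    (hf : ∀ u w, sympForm m u w = 1 → f (u + w) = f u + f w) {a x b y : SympVec m}
    (hax : IsIsotropicPair a x) (hby : IsIsotropicPair b y) :
    additivityDefect f a x = additivityDefect f b y := by
  by_cases hab : a = b
  · subst hab
    exact additivityDefect_right_eq hf hax hby
  rcases ZMod.eq_zero_or_eq_one_of_two (sympForm m a b) with h | h
  · have hp : IsIsotropicPair a b := ⟨hax.1, hby.1, hab, h⟩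
    rw [additivityDefect_right_eq hf hax hp, additivityDefect_comm,
      additivityDefect_right_eq hf hp.symm hby]
  · obtain ⟨z, hz, haz, hbz⟩ := exists_ne_zero_sympForm_eq_zero hm a b
    have hpa : IsIsotropicPair a z :=
      ⟨hax.1, hz, by rintro rfl; simp [sympForm_comm, h] at hbz, haz⟩
    have hpb : IsIsotropicPair b z := ⟨hby.1, hz, by rintro rfl; simp [h] at haz, hbz⟩
    rw [additivityDefect_right_eq hf hax hpa, additivityDefect_comm,
      additivityDefect_right_eq hf hpa.symm hpb.symm, additivityDefect_comm,
      additivityDefect_right_eq hf hpb hby]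

namespace IsDualCocycle

variable {c : SpTwo m → Dual (ZMod 2) (SympVec m)}

theorem map_one (hc : IsDualCocycle c) (v : SympVec m) : c 1 v = 0 := by
  simpa using hc 1 1 v

theorem add {c' : SpTwo m → Dual (ZMod 2) (SympVec m)} (hc : IsDualCocycle c)
    (hc' : IsDualCocycle c') : IsDualCocycle (c + c') := fun g h v => by
  simp only [Pi.add_apply, LinearMap.add_apply, hc g h v, hc' g h v]
  ring

theorem transvec_apply_self (hc : IsDualCocycle c) (u : SympVec m) :
    c (transvec u) u = 0 := by
  by_cases hu : u = 0
  · simp [hu]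
  obtain ⟨v, hv⟩ := exists_sympForm_eq_one hu
  have h := hc (transvec u) (transvec u) v
  rw [transvec_mul_self, hc.map_one, transvec_mulVec, hv, one_smul, map_add] at h
  linear_combination -h - CharTwo.add_self_eq_zero (c (transvec u) v)

theorem transvec_apply_of_sympForm_eq_zero (hc : IsDualCocycle c) {u w : SympVec m}
    (h : sympForm m w u = 0) : c (transvec u) w = 0 := by
  by_cases hw : w = 0
  · simp [hw]
  by_cases huw : u = w
  · rw [huw, hc.transvec_apply_self]
  obtain ⟨v, hvu, hvw⟩ := exists_sympForm_eq_zero_eq_one hw huw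
  have e := mul_transvec (transvec u) w
  rw [transvec_mulVec, h, zero_smul, add_zero] at e
  have e := congrArg (fun g => c g v) e
  simp only [hc _ _ v, transvec_mulVec, hvu, hvw, one_smul, zero_smul, add_zero, map_add] at e
  linear_combination e

/-- The value of a cocycle at the transvection with centre `u` is a multiple of `B(·, u)`. -/
theorem exists_transvec_apply_eq (hc : IsDualCocycle c) :
    ∃ f : SympVec m → ZMod 2, f 0 = 0 ∧ ∀ u v, c (transvec u) v = sympForm m v u * f u := by
  have key : ∀ u, ∃ a, (u = 0 → a = 0) ∧ ∀ v, c (transvec u) v = sympForm m v u * a := by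
    intro u
    by_cases hu : u = 0
    · exact ⟨0, fun _ => rfl, fun v => by rw [hu, transvec_zero, hc.map_one, mul_zero]⟩
    obtain ⟨w, hw⟩ := exists_sympForm_eq_one hu
    refine ⟨c (transvec u) w, fun h => absurd h hu, fun v => ?_⟩
    rcases ZMod.eq_zero_or_eq_one_of_two (sympForm m v u) with h | h
    · rw [hc.transvec_apply_of_sympForm_eq_zero h, h, zero_mul]
    · have h' := hc.transvec_apply_of_sympForm_eq_zero (u := u) (w := v - w) (by simp [h, hw])
      rw [map_sub, sub_eq_zero] at h'
      rw [h', h, one_mul]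
  choose f hf using key
  exact ⟨f, (hf 0).1 rfl, fun u => (hf u).2⟩

theorem map_add_of_sympForm_eq_one (hc : IsDualCocycle c) {f : SympVec m → ZMod 2}
    (hf : ∀ u v, c (transvec u) v = sympForm m v u * f u) {u w : SympVec m}
    (h : sympForm m u w = 1) : f (u + w) = f u + f w := by
  have h' : sympForm m w u = 1 := by rwa [sympForm_comm]
  have e := mul_transvec (transvec u) w
  rw [transvec_mulVec, h', one_smul] at e
  have e := congrArg (fun g => c g u) e
  simp only [hc _ _ u, hf, transvec_mulVec, h, h', one_smul, zero_smul, add_zero, map_add,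
    LinearMap.add_apply, sympForm_self] at e
  rw [add_comm u w]
  linear_combination -e

theorem eq_zero_of_transvec (hc : IsDualCocycle c) (h : ∀ u v, c (transvec u) v = 0)
    (g : SpTwo m) (v : SympVec m) : c g v = 0 := by
  by_cases hv : v = 0
  · simp [hv]
  obtain ⟨w, hw⟩ := exists_sympForm_eq_one hv
  have e := congrArg (fun g => c g w) (mul_transvec g v)
  simp only [hc _ _ w, h, transvec_mulVec, hw, one_smul, map_add] at e
  linear_combination e

theorem isDualCoboundary (hc : IsDualCocycle c) {f : SympVec m → ZMod 2} (hf0 : f 0 = 0)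
    (hf : ∀ u v, c (transvec u) v = sympForm m v u * f u)
    (hD : ∀ a x, IsIsotropicPair a x → additivityDefect f a x = 0) : IsDualCoboundary c := by
  have hadd : ∀ a x, f (a + x) = f a + f x := by
    intro a x
    by_cases ha : a = 0
    · simp [ha, hf0]
    by_cases hx : x = 0
    · simp [hx, hf0]
    by_cases hax : a = x
    · simp [hax, ZModModule.add_self, hf0]
    rcases ZMod.eq_zero_or_eq_one_of_two (sympForm m a x) with h | h
    · have := hD a x ⟨ha, hx, hax, h⟩
      rwa [additivityDefect, add_assoc, CharTwo.add_eq_zero] at this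
    · exact hc.map_add_of_sympForm_eq_one hf h
  let l : Dual (ZMod 2) (SympVec m) := (AddMonoidHom.mk' f hadd).toZModLinearMap 2
  have hl : ∀ v, l v = f v := fun _ => rfl
  let d : SpTwo m → Dual (ZMod 2) (SympVec m) := fun g => l ∘ₗ Matrix.mulVecLin g.1 + l
  have hd : ∀ g v, d g v = l (g.1.mulVec v) + l v := fun _ _ => rfl
  have hdc : IsDualCocycle d := fun g h v => by
    rw [hd, hd, hd, SpTwo.mul_mulVec]
    linear_combination -CharTwo.add_self_eq_zero (l (h.1.mulVec v))
  refine ⟨l, fun g v => ?_⟩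
  have := (hc.add hdc).eq_zero_of_transvec (fun u v => ?_) g v
  · rwa [Pi.add_apply, LinearMap.add_apply, hd, CharTwo.add_eq_zero] at this
  · rw [Pi.add_apply, LinearMap.add_apply, hd, hf, transvec_mulVec, map_add, map_smul, hl u,
      smul_eq_mul]
    linear_combination CharTwo.add_self_eq_zero (sympForm m v u * f u) +
      CharTwo.add_self_eq_zero (l v)

/-- The first cohomology group of `Sp(2m, F₂)` on the dual of the natural module has at most two
elements. -/
theorem isDualCoboundary_add (hm : 2 ≤ m) {c' : SpTwo m → Dual (ZMod 2) (SympVec m)}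
    (hc : IsDualCocycle c) (hc' : IsDualCocycle c') (hn : ¬ IsDualCoboundary c)
    (hn' : ¬ IsDualCoboundary c') : IsDualCoboundary (c + c') := by
  have one : ∀ {c : SpTwo m → Dual (ZMod 2) (SympVec m)} {f : SympVec m → ZMod 2},
      IsDualCocycle c → ¬ IsDualCoboundary c → f 0 = 0 →
      (∀ u v, c (transvec u) v = sympForm m v u * f u) →
      ∀ a x, IsIsotropicPair a x → additivityDefect f a x = 1 := by
    intro c f hc hn hf0 hf a x hax
    by_contra hne
    refine hn (hc.isDualCoboundary hf0 hf fun b y hby => ?_)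
    rw [← additivityDefect_eq hm (fun _ _ => hc.map_add_of_sympForm_eq_one hf) hax hby]
    exact (ZMod.eq_zero_or_eq_one_of_two _).resolve_right hne
  obtain ⟨f, hf0, hf⟩ := hc.exists_transvec_apply_eq
  obtain ⟨f', hf0', hf'⟩ := hc'.exists_transvec_apply_eq
  refine (hc.add hc').isDualCoboundary (f := f + f') (by simp [hf0, hf0'])
    (fun u v => by simp [hf, hf', mul_add]) fun a x hax => ?_
  have h := one hc hn hf0 hf a x hax
  have h' := one hc' hn' hf0' hf' a x hax
  rw [additivityDefect] at h h' ⊢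
  simp only [Pi.add_apply]
  linear_combination h + h' + CharTwo.add_self_eq_zero (1 : ZMod 2)

end IsDualCocycle

end Cocycle

section Existence

variable {m : ℕ}

/-- The quadratic form `∑ xᵢ yᵢ` on `F₂^(2m)`. -/
def sympQuad (v : SympVec m) : ZMod 2 := ∑ i, v (.inl i) * v (.inr i)

theorem sympQuad_add (v w : SympVec m) :
    sympQuad (v + w) = sympQuad v + sympQuad w + sympForm m v w := by
  simp only [sympQuad, sympForm_apply, ← Finset.sum_add_distrib, Pi.add_apply]
  exact Finset.sum_congr rfl fun i _ => by ring

/-- The linear functional `v ↦ q(g v) + q(v)`. -/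
def quadCocycle (g : SpTwo m) : Dual (ZMod 2) (SympVec m) :=
  (AddMonoidHom.mk' (fun v => sympQuad (g.1.mulVec v) + sympQuad v) fun v w => by
    rw [Matrix.mulVec_add, sympQuad_add, sympQuad_add, sympForm_mulVec]
    linear_combination CharTwo.add_self_eq_zero (sympForm m v w)).toZModLinearMap 2

theorem quadCocycle_apply (g : SpTwo m) (v : SympVec m) :
    quadCocycle g v = sympQuad (g.1.mulVec v) + sympQuad v := rfl

/-- The action of `Sp(2m, F₂)` on the orthogonal module of dimension `2m + 1`. -/
def orthogonalEnd : SpTwo m →* Module.End (ZMod 2) (SympVec m × ZMod 2) where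
  toFun g := (Matrix.mulVecLin g.1 ∘ₗ LinearMap.fst _ _ _).prod
    (LinearMap.snd _ _ _ + quadCocycle g ∘ₗ LinearMap.fst _ _ _)
  map_one' := by
    refine LinearMap.ext fun x => Prod.ext ?_ ?_
    · simp
    · simp [quadCocycle_apply, CharTwo.add_self_eq_zero]
  map_mul' g h := by
    refine LinearMap.ext fun x => Prod.ext ?_ ?_
    · simp
    · simp [quadCocycle_apply]
      linear_combination -CharTwo.add_self_eq_zero (sympQuad (h.1.mulVec x.1))

/-- The action of `Sp(2m, F₂)` on the orthogonal module of dimension `2m + 1`, by linear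
automorphisms. -/
def orthogonalRep : SpTwo m →* ((SympVec m × ZMod 2) ≃ₗ[ZMod 2] (SympVec m × ZMod 2)) :=
  (LinearMap.GeneralLinearGroup.generalLinearEquiv _ _).toMonoidHom.comp
    (MonoidHom.toHomUnits orthogonalEnd)

theorem orthogonalRep_apply (g : SpTwo m) (x : SympVec m × ZMod 2) :
    orthogonalRep g x = (g.1.mulVec x.1, x.2 + (sympQuad (g.1.mulVec x.1) + sympQuad x.1)) :=
  rfl

/-- An invariant subspace of the orthogonal module that is not contained in the trivial line is
everything. -/
theorem eq_top_of_orthogonalRep_invariant (hm : 2 ≤ m)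
    {W : Submodule (ZMod 2) (SympVec m × ZMod 2)}
    (hW : ∀ g, ∀ x ∈ W, orthogonalRep g x ∈ W) {x : SympVec m × ZMod 2} (hx : x ∈ W)
    (hx0 : x.1 ≠ 0) : W = ⊤ := by
  have step : ∀ y ∈ W, ∀ u, sympForm m y.1 u = 1 → (u, sympQuad u + 1) ∈ W := by
    intro y hy u hu
    convert W.sub_mem (hW (transvec u) y hy) hy using 1
    rw [orthogonalRep_apply, transvec_mulVec, sympQuad_add, hu, one_smul, hu]
    refine Prod.ext (by simp) ?_
    simp only [Prod.snd_sub]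
    linear_combination -CharTwo.add_self_eq_zero (sympQuad y.1)
  have lift : ∀ u, u ≠ 0 → (u, sympQuad u + 1) ∈ W := by
    intro u hu
    obtain ⟨v, hvx, hvu⟩ := exists_sympForm_eq_one_both hx0 hu
    exact step _ (step x hx v (by rwa [sympForm_comm])) u hvu
  have line : ((0 : SympVec m), (1 : ZMod 2)) ∈ W := by
    obtain ⟨b, hb⟩ := exists_sympForm_eq_one hx0
    obtain ⟨z, hz, hxz, hbz⟩ := exists_ne_zero_sympForm_eq_zero hm x.1 b
    have hne : x.1 + z ≠ 0 := by
      rw [Ne, add_eq_zero_iff_eq_neg, ZModModule.neg_eq_self]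
      intro h
      rw [h, hbz] at hb
      exact zero_ne_one hb
    convert W.add_mem (W.add_mem (lift _ hx0) (lift _ hz)) (lift _ hne) using 1
    refine Prod.ext (ZModModule.add_self _).symm ?_
    simp only [Prod.snd_add, sympQuad_add, hxz]
    linear_combination -CharTwo.add_self_eq_zero (sympQuad x.1 + sympQuad z + 1)
  rw [eq_top_iff]
  rintro ⟨v, a⟩ -
  have hline : ∀ b : ZMod 2, ((0 : SympVec m), b) ∈ W := fun b => by
    simpa using W.smul_mem b line
  by_cases hv : v = 0
  · rw [hv]
    exact hline a
  · simpa using W.add_mem (lift v hv) (hline (a - (sympQuad v + 1)))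

theorem naturalExtension_nonempty (hm : 2 ≤ m) : Nonempty (NaturalExtension m) := by
  refine ⟨{
    U := SympVec m × ZMod 2
    ρ := orthogonalRep
    U₀ := LinearMap.ker (LinearMap.fst (ZMod 2) (SympVec m) (ZMod 2))
    hdim := ?_
    htriv := ?_
    hquot := ?_
    hindec := ?_ }⟩
  · rw [LinearMap.ker_fst, LinearMap.finrank_range_of_inj LinearMap.inr_injective,
      Module.finrank_self]
  · rintro g ⟨v, a⟩ hv
    obtain rfl : v = 0 := by simpa using hv
    simp [orthogonalRep_apply, CharTwo.add_self_eq_zero]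
  · exact ⟨LinearMap.quotKerEquivOfSurjective _ LinearMap.fst_surjective, fun g u => rfl⟩
  · intro W₁ W₂ h₁ h₂ hc
    have key : ∀ W : Submodule (ZMod 2) (SympVec m × ZMod 2),
        (∀ g : SpTwo m, W.map (orthogonalRep g).toLinearMap ≤ W) →
        W = ⊤ ∨ W ≤ LinearMap.ker (LinearMap.fst (ZMod 2) (SympVec m) (ZMod 2)) := by
      intro W hW
      rw [or_iff_not_imp_right, SetLike.not_le_iff_exists]
      rintro ⟨x, hx, hx0⟩
      exact eq_top_of_orthogonalRep_invariant hm
        (fun g y hy => hW g (Submodule.mem_map_of_mem hy)) hx hx0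
    rcases key W₁ h₁ with h | h
    · exact Or.inr (by simpa [h] using hc.inf_eq_bot)
    rcases key W₂ h₂ with h' | h'
    · exact Or.inl (by simpa [h'] using hc.inf_eq_bot)
    have htop := sup_le h h'
    rw [hc.sup_eq_top, top_le_iff] at htop
    have := LinearMap.ker_eq_top.mp htop
    have h1 := LinearMap.congr_fun this (fun _ => 1, 0)
    exact absurd (congrFun h1 (.inl ⟨0, by omega⟩)) one_ne_zero

end Existence

section Uniqueness

variable {m : ℕ}

/-- Coordinates on an extension in which the projection to the natural module is the first
component. -/
theorem NaturalExtension.exists_coordinates (X : NaturalExtension m) :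
    ∃ e : X.U ≃ₗ[ZMod 2] SympVec m × ZMod 2,
      (∀ g x, (e (X.ρ g x)).1 = g.1.mulVec (e x).1) ∧
      ∀ g x, (e x).1 = 0 → X.ρ g x = x := by
  obtain ⟨φ, hφ⟩ := X.hquot
  have : Module.Finite (ZMod 2) X.U₀ := Module.finite_of_finrank_eq_succ X.hdim
  obtain ⟨r₀⟩ := FiniteDimensional.nonempty_linearEquiv_of_finrank_eq
    (X.hdim.trans (Module.finrank_self (ZMod 2)).symm)
  obtain ⟨r, hr⟩ := r₀.toLinearMap.exists_extend
  have hr : ∀ x : X.U₀, r x = r₀ x := LinearMap.congr_fun hr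
  let p : X.U →ₗ[ZMod 2] SympVec m := φ.toLinearMap ∘ₗ X.U₀.mkQ
  have hp : ∀ x, p x = 0 ↔ x ∈ X.U₀ := fun x => by simp [p]
  have hbij : Function.Bijective (p.prod r) := by
    refine ⟨(injective_iff_map_eq_zero _).mpr fun x hx => ?_, fun ⟨v, a⟩ => ?_⟩
    · obtain ⟨h₁, h₂⟩ := Prod.mk.inj hx
      have h₁ := (hp x).mp h₁
      have h₂ : r₀ ⟨x, h₁⟩ = 0 := (hr ⟨x, h₁⟩).symm.trans h₂
      exact congrArg Subtype.val (r₀.map_eq_zero_iff.mp h₂)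
    · obtain ⟨x, rfl⟩ := φ.surjective.comp X.U₀.mkQ_surjective v
      refine ⟨x + r₀.symm (a - r x), Prod.ext ?_ ?_⟩
      · exact (map_add p _ _).trans (by rw [(hp _).mpr (r₀.symm _).2, add_zero]; rfl)
      · simp [hr]
  exact ⟨LinearEquiv.ofBijective _ hbij, fun g x => hφ g x,
    fun g x hx => X.htriv g x ((hp x).mp hx)⟩

/-- An indecomposable extension of the natural module is given by a nontrivial cocycle. -/
theorem NaturalExtension.exists_cocycle (hm : 2 ≤ m) (X : NaturalExtension m) :
    ∃ (c : SpTwo m → Dual (ZMod 2) (SympVec m)) (e : X.U ≃ₗ[ZMod 2] SympVec m × ZMod 2),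
      IsDualCocycle c ∧ ¬ IsDualCoboundary c ∧
      ∀ g x, e (X.ρ g x) = (g.1.mulVec (e x).1, (e x).2 + c g (e x).1) := by
  obtain ⟨e, he₁, he₂⟩ := X.exists_coordinates
  let c : SpTwo m → Dual (ZMod 2) (SympVec m) := fun g =>
    LinearMap.snd _ _ _ ∘ₗ e.toLinearMap ∘ₗ (X.ρ g).toLinearMap ∘ₗ e.symm.toLinearMap ∘ₗ
      LinearMap.inl _ _ _
  have hc : ∀ g v, c g v = (e (X.ρ g (e.symm (v, 0)))).2 := fun _ _ => rfl
  have he : ∀ g x, e (X.ρ g x) = (g.1.mulVec (e x).1, (e x).2 + c g (e x).1) := by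
    intro g x
    refine Prod.ext (he₁ g x) ?_
    have hx : x = e.symm (0, (e x).2) + e.symm ((e x).1, 0) := by
      rw [← map_add, LinearEquiv.eq_symm_apply]
      simp
    conv_lhs => rw [hx, map_add, he₂ g (e.symm (0, (e x).2)) (by simp)]
    simp [hc]
  refine ⟨c, e, fun g h v => ?_, ?_, he⟩
  · have e₁ := hc (g * h) v
    rw [map_mul, LinearEquiv.mul_apply, he, he, LinearEquiv.apply_symm_apply] at e₁
    rw [e₁]
    ring
  · rintro ⟨l, hl⟩
    let W₁ : Submodule (ZMod 2) X.U := LinearMap.ker (LinearMap.fst _ _ _ ∘ₗ e.toLinearMap)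
    let W₂ : Submodule (ZMod 2) X.U := LinearMap.ker
      ((LinearMap.snd _ _ _ + l ∘ₗ LinearMap.fst _ _ _) ∘ₗ e.toLinearMap)
    have h₁ : ∀ x, x ∈ W₁ ↔ (e x).1 = 0 := fun _ => Iff.rfl
    have h₂ : ∀ x, x ∈ W₂ ↔ (e x).2 + l (e x).1 = 0 := fun _ => Iff.rfl
    have hcompl : IsCompl W₁ W₂ := by
      refine ⟨Submodule.disjoint_def.mpr fun x hx hx' => ?_,
        codisjoint_iff_le_sup.mpr fun x _ => ?_⟩
      · rw [h₁] at hx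
        rw [h₂, hx, map_zero, add_zero] at hx'
        exact e.map_eq_zero_iff.mp (Prod.ext hx hx')
      · refine Submodule.mem_sup.mpr ⟨e.symm (0, (e x).2 + l (e x).1), ?_,
          e.symm ((e x).1, l (e x).1), ?_, ?_⟩
        · simp [h₁]
        · simp [h₂, CharTwo.add_self_eq_zero]
        · rw [← map_add, LinearEquiv.symm_apply_eq]
          simp [add_assoc, CharTwo.add_self_eq_zero]
    have inv₁ : ∀ g : SpTwo m, W₁.map (X.ρ g).toLinearMap ≤ W₁ := by
      rintro g _ ⟨x, hx, rfl⟩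
      rw [SetLike.mem_coe, h₁] at hx
      rw [LinearEquiv.coe_coe, h₁, he₁, hx, Matrix.mulVec_zero]
    have inv₂ : ∀ g : SpTwo m, W₂.map (X.ρ g).toLinearMap ≤ W₂ := by
      rintro g _ ⟨x, hx, rfl⟩
      rw [SetLike.mem_coe, h₂] at hx
      rw [LinearEquiv.coe_coe, h₂, he, hl]
      linear_combination hx + CharTwo.add_self_eq_zero (l (g.1.mulVec (e x).1))
    rcases X.hindec W₁ W₂ inv₁ inv₂ hcompl with h | h
    · have hmem : e.symm (0, 1) ∈ W₁ := by simp [h₁]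
      simp [h] at hmem
    · have hmem : e.symm (fun _ => 1, l fun _ => 1) ∈ W₂ := by
        simp [h₂, CharTwo.add_self_eq_zero]
      rw [h, Submodule.mem_bot, LinearEquiv.map_eq_zero_iff] at hmem
      exact one_ne_zero (congrFun (congrArg Prod.fst hmem) (.inl ⟨0, by omega⟩))

theorem NaturalExtension.exists_equiv (hm : 2 ≤ m) (X Y : NaturalExtension m) :
    ∃ ψ : X.U ≃ₗ[ZMod 2] Y.U, ∀ (g : SpTwo m) (u : X.U), ψ (X.ρ g u) = Y.ρ g (ψ u) := by
  obtain ⟨c, e, hc, hn, he⟩ := X.exists_cocycle hm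
  obtain ⟨c', e', hc', hn', he'⟩ := Y.exists_cocycle hm
  obtain ⟨l, hl⟩ := hc.isDualCoboundary_add hm hc' hn hn'
  let s : (SympVec m × ZMod 2) ≃ₗ[ZMod 2] (SympVec m × ZMod 2) :=
    (LinearEquiv.refl _ _).skewProd (LinearEquiv.refl _ _) l
  have hs : ∀ x, s x = (x.1, x.2 + l x.1) := fun _ => rfl
  refine ⟨e.trans (s.trans e'.symm), fun g u => e'.injective ?_⟩
  rw [he']
  simp only [LinearEquiv.trans_apply, LinearEquiv.apply_symm_apply, he, hs]
  refine Prod.ext rfl ?_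
  have h := hl g (e u).1
  rw [Pi.add_apply, LinearMap.add_apply] at h
  linear_combination h - CharTwo.add_self_eq_zero (c' g (e u).1) +
    CharTwo.add_self_eq_zero (l (g.1.mulVec (e u).1))

end Uniqueness

theorem natural_extension_exists_unique (m : ℕ) (hm : 2 ≤ m) :
    Nonempty (NaturalExtension m) ∧
    ∀ X Y : NaturalExtension m,
      ∃ ψ : X.U ≃ₗ[ZMod 2] Y.U,
        ∀ (g : Matrix.symplecticGroup (Fin m) (ZMod 2)) (u : X.U),
          ψ (X.ρ g u) = Y.ρ g (ψ u) := by
  exact ⟨naturalExtension_nonempty hm, NaturalExtension.exists_equiv hm⟩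
end
end

section
/- Let p be an odd prime, m ≥ 1, and let E be an extraspecial p-group of order p^(1+2m) and exponent p. Then for every non-trivial group homomorphism χ : Z(E) → ℂˣ there exists, up to isomorphism, exactly one finite-dimensional irreducible complex representation of E whose restriction to the center Z(E) is given by scalar multiplication by χ, and this representation is faithful; consequently E has exactly p − 1 isomorphism classes of faithful irreducible complex representations. -/
open Module

noncomputable section

/-- A finite `p`-group is extraspecial if its center has order `p`, its commutator
subgroup equals its center, and the central quotient is a nontrivial elementary
abelian `p`-group. -/
def IsExtraspecial (p : ℕ) (E : Type) [Group E] : Prop :=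
  Nat.card (Subgroup.center E) = p ∧
  commutator E = Subgroup.center E ∧
  Nontrivial (E ⧸ Subgroup.center E) ∧
  ∀ x : E ⧸ Subgroup.center E, x ^ p = 1

/-- A complex representation of a group `E`. -/
structure CRep (E : Type) [Group E] where
  W : Type
  [acg : AddCommGroup W]
  [mod : Module ℂ W]
  ρ : Representation ℂ E W

attribute [instance] CRep.acg CRep.mod

/-- Irreducibility of a complex representation. -/
def CRep.Irreducible {E : Type} [Group E] (R : CRep E) : Prop :=
  Nontrivial R.W ∧
    ∀ U : Submodule ℂ R.W, (∀ e : E, U.map (R.ρ e) ≤ U) → U = ⊥ ∨ U = ⊤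

/-- The restriction of `R` to the center is given by scalar multiplication by `χ`. -/
def CRep.HasCentralChar {E : Type} [Group E] (R : CRep E)
    (χ : Subgroup.center E →* ℂˣ) : Prop :=
  ∀ (z : Subgroup.center E) (w : R.W), R.ρ (z : E) w = (χ z : ℂ) • w

/-- Isomorphism of complex representations. -/
def RepIso {E : Type} [Group E] (R R' : CRep E) : Prop :=
  ∃ φ : R.W ≃ₗ[ℂ] R'.W, ∀ (e : E) (w : R.W), φ (R.ρ e w) = R'.ρ e (φ w)

open scoped commutatorElement

/-- The bundled notion of irreducibility agrees with Mathlib's `Representation.IsIrreducible`. -/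
theorem CRep.Irreducible.isIrreducible {E : Type} [Group E] {R : CRep E} (h : R.Irreducible) :
    R.ρ.IsIrreducible := by
  have := h.1
  refine { exists_pair_ne := ⟨⊥, ⊤, fun hbt => ?_⟩, eq_bot_or_eq_top := fun U => ?_ }
  · exact bot_ne_top (α := Submodule ℂ R.W)
      (congrArg Subrepresentation.toSubmodule hbt)
  · refine (h.2 U.toSubmodule fun e => ?_).imp
      (fun hU => Subrepresentation.toSubmodule_injective hU)
      (fun hU => Subrepresentation.toSubmodule_injective hU)
    rintro _ ⟨w, hw, rfl⟩
    exact U.apply_mem_toSubmodule e hw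

theorem repIso_iff_nonempty_equiv {E : Type} [Group E] {R R' : CRep E} :
    RepIso R R' ↔ Nonempty (R.ρ.Equiv R'.ρ) := by
  constructor
  · rintro ⟨φ, hφ⟩
    exact ⟨.mk φ fun g => LinearMap.ext fun w => hφ g w⟩
  · rintro ⟨φ⟩
    exact ⟨φ.toLinearEquiv, fun e w => Representation.IntertwiningMap.isIntertwining _ _ φ.toIntertwiningMap e w⟩

/-- Every character of the center of a finite group is the central character of some
irreducible representation. -/
theorem exists_irreducible_hasCentralChar {E : Type} [Group E] [Finite E]
    (χ : Subgroup.center E →* ℂˣ) :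
    ∃ R : CRep E, FiniteDimensional ℂ R.W ∧ R.Irreducible ∧ R.HasCentralChar χ := by
  classical
  let ρ : Representation ℂ E (E → ℂ) :=
    { toFun := fun e => LinearMap.funLeft ℂ ℂ (· * e)
      map_one' := by ext; simp [LinearMap.funLeft_apply]
      map_mul' := fun a b => LinearMap.ext fun f => funext fun x => by
        simp [LinearMap.funLeft_apply, mul_assoc] }
  have hρ (e : E) (f : E → ℂ) (x : E) : ρ e f x = f (x * e) := rfl
  let V : Submodule ℂ (E → ℂ) :=
    { carrier := {f | ∀ (z : Subgroup.center E) (x : E), f (x * z) = χ z * f x}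
      add_mem' := fun hf hg z x => by simp [hf z x, hg z x, mul_add]
      zero_mem' := fun z x => by simp
      smul_mem' := fun c f hf z x => by simp [hf z x, mul_left_comm] }
  have hVinv (e : E) {f : E → ℂ} (hf : f ∈ V) : ρ e f ∈ V := fun z x => by
    rw [hρ, hρ, mul_assoc, ← Subgroup.mem_center_iff.1 z.2 e, ← mul_assoc, hf]
  have hVne : V ≠ ⊥ := by
    let f : E → ℂ := fun x => if hx : x ∈ Subgroup.center E then χ ⟨x, hx⟩ else 0
    have hf : f ∈ V := fun z x => by
      by_cases hx : x ∈ Subgroup.center E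
      · have hxz : x * z ∈ Subgroup.center E := mul_mem hx z.2
        have : (⟨x * z, hxz⟩ : Subgroup.center E) = z * ⟨x, hx⟩ := Subtype.ext (Subgroup.mem_center_iff.1 z.2 x)
        simp only [f, dif_pos hx, dif_pos hxz, this, map_mul, Units.val_mul]
      · have hxz : x * z ∉ Subgroup.center E := by rwa [Subgroup.mul_mem_cancel_right _ z.2]
        simp only [f, dif_neg hx, dif_neg hxz, mul_zero]
    intro hV
    rw [hV, Submodule.mem_bot] at hf
    simpa [f] using congrFun hf 1
  obtain ⟨U, ⟨hUne, hUV, hUinv⟩, hUmin⟩ := exists_minimal_of_wellFoundedLT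
    (fun U : Submodule ℂ (E → ℂ) => U ≠ ⊥ ∧ U ≤ V ∧ ∀ e, ∀ f ∈ U, ρ e f ∈ U)
    ⟨V, hVne, le_rfl, fun e _ hf => hVinv e hf⟩
  let σ : Subrepresentation ρ := ⟨U, fun e f hf => hUinv e f hf⟩
  refine ⟨⟨U, σ.toRepresentation⟩, inferInstanceAs (FiniteDimensional ℂ U),
    ⟨Submodule.nontrivial_iff_ne_bot.2 hUne, fun T hT => ?_⟩, fun z w => ?_⟩
  · change Submodule ℂ U at T
    refine or_iff_not_imp_left.2 fun hTne => ?_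
    have hle : U ≤ T.map U.subtype := by
      refine hUmin ⟨?_, (Submodule.map_subtype_le U T).trans hUV, ?_⟩ (Submodule.map_subtype_le U T)
      · rwa [Ne, ← Submodule.map_bot U.subtype,
          (Submodule.map_injective_of_injective U.injective_subtype).eq_iff]
      · rintro e _ ⟨w, hw, rfl⟩
        exact ⟨σ.toRepresentation e w, hT e ⟨w, hw, rfl⟩, rfl⟩
    refine eq_top_iff.2 fun w _ => ?_
    obtain ⟨w', hw', hww'⟩ := hle w.2
    exact Subtype.ext hww' ▸ hw'
  · exact Subtype.ext (funext fun x => hUV w.2 z x)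

/-- Schur's lemma: a finite-dimensional irreducible representation has a central character. -/
theorem CRep.Irreducible.exists_hasCentralChar {E : Type} [Group E] {R : CRep E}
    [FiniteDimensional ℂ R.W] (h : R.Irreducible) :
    ∃ χ : Subgroup.center E →* ℂˣ, R.HasCentralChar χ := by
  have := h.1
  have := h.isIrreducible
  have hscalar (z : Subgroup.center E) : ∃ c : ℂ, ∀ w, R.ρ z w = c • w := by
    let f : Representation.IntertwiningMap R.ρ R.ρ := ⟨R.ρ z, fun g => by
      rw [← Module.End.mul_eq_comp, ← Module.End.mul_eq_comp, ← map_mul, ← map_mul,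
        Subgroup.mem_center_iff.1 z.2 g]⟩
    obtain ⟨c, hc⟩ :=
      (Representation.IsIrreducible.algebraMap_intertwiningMap_bijective_of_isAlgClosed
        (ρ := R.ρ)).2 f
    exact ⟨c, fun w => (congrArg (fun k : Representation.IntertwiningMap R.ρ R.ρ => k w) hc).symm⟩
  choose c hc using hscalar
  obtain ⟨w, hw⟩ := exists_ne (0 : R.W)
  let χ : Subgroup.center E →* ℂ :=
    { toFun := c
      map_one' := smul_left_injective ℂ hw (by simp [← hc])
      map_mul' := fun x y => smul_left_injective ℂ hw (by
        simp only [mul_smul, ← hc, Subgroup.coe_mul, map_mul, Module.End.mul_apply]) }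
  exact ⟨χ.toHomUnits, hc⟩

theorem CRep.HasCentralChar.eq_of_repIso {E : Type} [Group E] {R R' : CRep E} [Nontrivial R'.W]
    {χ χ' : Subgroup.center E →* ℂˣ} (h : R.HasCentralChar χ) (h' : R'.HasCentralChar χ')
    (hiso : RepIso R R') : χ = χ' := by
  obtain ⟨φ, hφ⟩ := hiso
  obtain ⟨w, hw⟩ := exists_ne (0 : R'.W)
  refine MonoidHom.ext fun z => Units.ext (smul_left_injective ℂ hw ?_)
  have := hφ z (φ.symm w)
  rwa [h, h', map_smul, φ.apply_symm_apply] at this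

/-- The character of a representation vanishes at `g` if `g` is conjugate to `z * g` for a
central element `z` acting by a scalar different from `1`. -/
theorem CRep.HasCentralChar.character_eq_zero {E : Type} [Group E] {R : CRep E}
    {χ : Subgroup.center E →* ℂˣ} (h : R.HasCentralChar χ) {g x : E} {z : Subgroup.center E}
    (hz : χ z ≠ 1) (hconj : x * g * x⁻¹ = z * g) : R.ρ.character g = 0 := by
  have hzg : R.ρ (z * g) = (χ z : ℂ) • R.ρ g := by
    rw [map_mul]
    exact LinearMap.ext fun w => h z _
  have htr : R.ρ.character g = χ z * R.ρ.character g := by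
    conv_lhs => rw [← Representation.char_conj R.ρ g x, hconj]
    rw [Representation.character, hzg, map_smul, smul_eq_mul, Representation.character]
  by_contra hne
  exact hz (Units.ext (mul_right_cancel₀ hne (by simpa using htr.symm)))

theorem CRep.HasCentralChar.character_center {E : Type} [Group E] {R : CRep E}
    [FiniteDimensional ℂ R.W]
    {χ : Subgroup.center E →* ℂˣ} (h : R.HasCentralChar χ) (z : Subgroup.center E) :
    R.ρ.character z = χ z * finrank ℂ R.W := by
  have hz : R.ρ z = (χ z : ℂ) • LinearMap.id := LinearMap.ext fun w => h z w
  rw [Representation.character, hz, map_smul, smul_eq_mul, LinearMap.trace_id]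

/-- If every noncentral element `g` is conjugate to some `z * g` with `z` central and `χ z ≠ 1`,
then there is at most one irreducible representation with central character `χ`. -/
theorem CRep.HasCentralChar.repIso {E : Type} [Group E] [Finite E] {R R' : CRep E}
    [FiniteDimensional ℂ R.W] [FiniteDimensional ℂ R'.W]
    {χ : Subgroup.center E →* ℂˣ} (h : R.HasCentralChar χ) (h' : R'.HasCentralChar χ)
    (hirr : R.Irreducible) (hirr' : R'.Irreducible)
    (hχ : ∀ g ∉ Subgroup.center E, ∃ (x : E) (z : Subgroup.center E),
      χ z ≠ 1 ∧ x * g * x⁻¹ = z * g) :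
    RepIso R R' := by
  classical
  have := Fintype.ofFinite E
  have := hirr.1
  have := hirr'.1
  have := hirr.isIrreducible
  have := hirr'.isIrreducible
  have hcardE : (Nat.card E : ℂ) ≠ 0 := Nat.cast_ne_zero.2 Nat.card_pos.ne'
  have := invertibleOfNonzero hcardE
  rw [repIso_iff_nonempty_equiv]
  by_contra hne
  have horth := Representation.char_orthonormal R'.ρ R.ρ
  rw [if_neg hne, mul_eq_zero, or_iff_right (inv_ne_zero hcardE)] at horth
  have hterm (g : E) : R'.ρ.character g * R.ρ.character g⁻¹ =
      if g ∈ Subgroup.center E then (finrank ℂ R'.W * finrank ℂ R.W : ℂ) else 0 := by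
    split_ifs with hg
    · have h1 := h'.character_center ⟨g, hg⟩
      have h2 := h.character_center ⟨g, hg⟩⁻¹
      simp only [Subgroup.coe_inv, map_inv, Units.val_inv_eq_inv_val] at h1 h2
      have := (χ ⟨g, hg⟩).ne_zero
      rw [h1, h2]
      field_simp
    · obtain ⟨x, z, hz, hconj⟩ := hχ g hg
      rw [h'.character_eq_zero hz hconj, zero_mul]
  rw [Finset.sum_congr rfl fun g _ => hterm g, ← Finset.sum_filter, Finset.sum_const,
    nsmul_eq_mul, mul_eq_zero, mul_eq_zero, Nat.cast_eq_zero, Nat.cast_eq_zero,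
    Nat.cast_eq_zero, Finset.card_eq_zero] at horth
  rcases horth with hc | hd | hd
  · have h1 : (1 : E) ∈ Finset.univ.filter (· ∈ Subgroup.center E) := by simp [one_mem]
    rw [hc] at h1
    exact Finset.notMem_empty 1 h1
  · exact finrank_pos.ne' hd
  · exact finrank_pos.ne' hd

/-- In a group whose commutators are central, a noncentral element is conjugate to a
nontrivial central multiple of itself. -/
theorem exists_conj_eq_center_mul {E : Type} [Group E] (hE : commutator E ≤ Subgroup.center E)
    {g : E} (hg : g ∉ Subgroup.center E) :
    ∃ (x : E) (z : Subgroup.center E), z ≠ 1 ∧ x * g * x⁻¹ = z * g := by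
  rw [Subgroup.mem_center_iff, not_forall] at hg
  obtain ⟨x, hx⟩ := hg
  have hmem : ⁅x, g⁆ ∈ commutator E :=
    Subgroup.commutator_mem_commutator (Subgroup.mem_top x) (Subgroup.mem_top g)
  refine ⟨x, ⟨⁅x, g⁆, hE hmem⟩, fun h1 => hx ?_, ?_⟩
  · exact commutatorElement_eq_one_iff_mul_comm.1 (congrArg Subtype.val h1)
  · simp [commutatorElement_def]

/-- A nontrivial homomorphism out of a group of prime order is injective. -/
theorem MonoidHom.injective_of_prime_card {G H : Type*} [Group G] [Group H]
    (hG : (Nat.card G).Prime) {f : G →* H} (hf : f ≠ 1) : Function.Injective f := by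
  have := Fact.mk hG
  rw [← MonoidHom.ker_eq_bot_iff]
  exact f.ker.eq_bot_or_eq_top_of_prime_card.resolve_right
    fun h => hf (MonoidHom.ker_eq_top_iff.1 h)

/-- If commutators are central, a representation with injective central character is faithful. -/
theorem CRep.HasCentralChar.injective {E : Type} [Group E] {R : CRep E} [Nontrivial R.W]
    {χ : Subgroup.center E →* ℂˣ} (h : R.HasCentralChar χ) (hχ : Function.Injective χ)
    (hE : commutator E ≤ Subgroup.center E) : Function.Injective R.ρ := by
  obtain ⟨w, hw⟩ := exists_ne (0 : R.W)
  have hcenter (z : Subgroup.center E) (hz : R.ρ z = 1) : z = 1 := by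
    refine hχ (Units.ext (smul_left_injective ℂ hw ?_))
    simp only [← h z w, hz, map_one, Units.val_one, one_smul, Module.End.one_apply]
  refine (injective_iff_map_eq_one R.ρ).2 fun g hg => ?_
  by_cases hgc : g ∈ Subgroup.center E
  · exact congrArg Subtype.val (hcenter ⟨g, hgc⟩ hg)
  · obtain ⟨x, z, hz, hconj⟩ := exists_conj_eq_center_mul hE hgc
    refine absurd (hcenter z ?_) hz
    have := congrArg R.ρ hconj
    rwa [map_mul, map_mul, map_mul, hg, mul_one, mul_one, ← map_mul, mul_inv_cancel, map_one,
      eq_comm] at this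

/-- A faithful representation of a group with nontrivial center has nontrivial central
character. -/
theorem CRep.HasCentralChar.ne_one {E : Type} [Group E] [Nontrivial (Subgroup.center E)]
    {R : CRep E} {χ : Subgroup.center E →* ℂˣ} (h : R.HasCentralChar χ)
    (hinj : Function.Injective R.ρ) : χ ≠ 1 := by
  rintro rfl
  obtain ⟨z, hz⟩ := exists_ne (1 : Subgroup.center E)
  refine hz (Subtype.ext (hinj (LinearMap.ext fun w => ?_)))
  simpa using h z w

open scoped IsMulCommutative in
theorem card_ne_one_monoidHom_units (Z : Type*) [Group Z] [IsMulCommutative Z] [Finite Z] :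
    Nat.card {χ : Z →* ℂˣ // χ ≠ 1} = Nat.card Z - 1 := by
  classical
  have hcard := CommGroup.card_monoidHom_of_hasEnoughRootsOfUnity Z ℂ
  have : Finite (Z →* ℂˣ) := Nat.finite_of_card_ne_zero (hcard ▸ Nat.card_pos.ne')
  have := Fintype.ofFinite (Z →* ℂˣ)
  rw [← hcard, Nat.card_eq_fintype_card, Nat.card_eq_fintype_card,
    Fintype.card_subtype_compl, Fintype.card_subtype_eq]

theorem extraspecial_reps_with_central_character
    (p : ℕ) (hp : p.Prime) (hodd : Odd p) (m : ℕ) (hm : 1 ≤ m)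
    (E : Type) [Group E] [Finite E]
    (hE : IsExtraspecial p E)
    (hcard : Nat.card E = p ^ (1 + 2 * m))
    (hexp : ∀ x : E, x ^ p = 1) :
    -- for each nontrivial central character there is exactly one irreducible
    -- representation with that central character, and it is faithful
    (∀ χ : Subgroup.center E →* ℂˣ, χ ≠ 1 →
      ∃ R : CRep E, FiniteDimensional ℂ R.W ∧ R.Irreducible ∧
        R.HasCentralChar χ ∧ Function.Injective R.ρ ∧
        ∀ R' : CRep E, FiniteDimensional ℂ R'.W → R'.Irreducible →
          R'.HasCentralChar χ → RepIso R' R) ∧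
    -- consequently `E` has exactly `p - 1` isomorphism classes of faithful
    -- irreducible complex representations
    (∃ Rs : Fin (p - 1) → CRep E,
      (∀ i, FiniteDimensional ℂ (Rs i).W ∧ (Rs i).Irreducible ∧
        Function.Injective (Rs i).ρ) ∧
      (∀ i j, RepIso (Rs i) (Rs j) → i = j) ∧
      ∀ R : CRep E, FiniteDimensional ℂ R.W → R.Irreducible →
        Function.Injective R.ρ → ∃ i, RepIso R (Rs i)) := by
  obtain ⟨hZ, hcomm, -, -⟩ := hE
  have hle : commutator E ≤ Subgroup.center E := hcomm.le
  have hZp : (Nat.card (Subgroup.center E)).Prime := hZ ▸ hp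
  have : Nontrivial (Subgroup.center E) := Finite.one_lt_card_iff_nontrivial.1 hZp.one_lt
  have hunique (χ : Subgroup.center E →* ℂˣ) (hχ : χ ≠ 1) (R R' : CRep E)
      (hfd : FiniteDimensional ℂ R.W) (hfd' : FiniteDimensional ℂ R'.W)
      (hirr : R.Irreducible) (hirr' : R'.Irreducible)
      (h : R.HasCentralChar χ) (h' : R'.HasCentralChar χ) : RepIso R R' :=
    h.repIso h' hirr hirr' fun g hg => by
      obtain ⟨x, z, hz, hconj⟩ := exists_conj_eq_center_mul hle hg
      exact ⟨x, z, (map_ne_one_iff χ (MonoidHom.injective_of_prime_card hZp hχ)).2 hz, hconj⟩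
  choose S hSfd hSirr hSχ using exists_irreducible_hasCentralChar (E := E)
  have hSinj (χ : Subgroup.center E →* ℂˣ) (hχ : χ ≠ 1) : Function.Injective (S χ).ρ :=
    have := (hSirr χ).1
    (hSχ χ).injective (MonoidHom.injective_of_prime_card hZp hχ) hle
  refine ⟨fun χ hχ => ⟨S χ, hSfd χ, hSirr χ, hSχ χ, hSinj χ hχ, fun R' hfd hirr h =>
    hunique χ hχ R' (S χ) hfd (hSfd χ) hirr (hSirr χ) h (hSχ χ)⟩, ?_⟩
  have hcount : Nat.card {χ : Subgroup.center E →* ℂˣ // χ ≠ 1} = p - 1 :=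
    hZ ▸ card_ne_one_monoidHom_units (Subgroup.center E)
  have : Finite {χ : Subgroup.center E →* ℂˣ // χ ≠ 1} :=
    Nat.finite_of_card_ne_zero (hcount ▸ (Nat.sub_pos_of_lt hp.one_lt).ne')
  let ε := (Finite.equivFinOfCardEq hcount).symm
  refine ⟨fun i => S (ε i), fun i => ⟨hSfd _, hSirr _, hSinj _ (ε i).2⟩, fun i j hij => ?_,
    fun R hfd hirr hinj => ?_⟩
  · have := (hSirr (ε j)).1
    exact ε.injective (Subtype.ext ((hSχ (ε i)).eq_of_repIso (hSχ (ε j)) hij))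
  · obtain ⟨χ, hχ⟩ := hirr.exists_hasCentralChar
    have hne := hχ.ne_one hinj
    refine ⟨ε.symm ⟨χ, hne⟩, ?_⟩
    simpa using hunique χ hne _ _ hfd (hSfd χ) hirr (hSirr χ) hχ (hSχ χ)
end
end

section
/- Let p be an odd prime, m ≥ 1, and let E be an extraspecial p-group of order p^(1+2m) and exponent p. If D and D' are two faithful finite-dimensional irreducible complex representations of E, then there exists a group automorphism γ of E such that D ∘ γ is isomorphic to D' as a representation of E; in particular, D(E) and D'(E) are conjugate subgroups of the general linear group (and may be taken equal). -/
open Module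

noncomputable section

open scoped commutatorElement

namespace Subgroup

variable {E : Type*} [Group E]

/-- The subgroup generated by `B` and an element `y` centralizing `B`. -/
def adjoinCommuting (B : Subgroup E) (y : E) (hy : ∀ b ∈ B, Commute b y) : Subgroup E where
  carrier := {g | ∃ b ∈ B, ∃ i : ℤ, g = b * y ^ i}
  one_mem' := ⟨1, B.one_mem, 0, by simp⟩
  mul_mem' := by
    rintro _ _ ⟨b, hb, i, rfl⟩ ⟨c, hc, j, rfl⟩
    refine ⟨b * c, B.mul_mem hb hc, i + j, ?_⟩
    rw [zpow_add, mul_assoc, ← mul_assoc (y ^ i), ((hy c hc).zpow_right i).symm.eq]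
    simp only [mul_assoc]
  inv_mem' := by
    rintro _ ⟨b, hb, i, rfl⟩
    refine ⟨b⁻¹, B.inv_mem hb, -i, ?_⟩
    rw [((hy b hb).zpow_right i).eq, mul_inv_rev, zpow_neg]

variable {B : Subgroup E} {y : E} {hy : ∀ b ∈ B, Commute b y}

theorem le_adjoinCommuting : B ≤ B.adjoinCommuting y hy :=
  fun b hb => ⟨b, hb, 0, by simp⟩

theorem self_mem_adjoinCommuting : y ∈ B.adjoinCommuting y hy :=
  ⟨1, B.one_mem, 1, by simp⟩

theorem adjoinCommuting_commute (hB : ∀ a ∈ B, ∀ b ∈ B, Commute a b) :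
    ∀ a ∈ B.adjoinCommuting y hy, ∀ b ∈ B.adjoinCommuting y hy, Commute a b := by
  rintro _ ⟨b, hb, i, rfl⟩ _ ⟨c, hc, j, rfl⟩
  exact ((hB b hb c hc).mul_right ((hy b hb).zpow_right j)).mul_left
    (((hy c hc).zpow_right i).symm.mul_right ((Commute.refl y).zpow_zpow i j))

variable (E) in
/-- A finite group has a self-centralizing abelian subgroup. -/
theorem exists_commute_self_centralizing [Finite E] :
    ∃ A : Subgroup E, (∀ a ∈ A, ∀ b ∈ A, Commute a b) ∧
      ∀ x, (∀ a ∈ A, Commute a x) → x ∈ A := by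
  obtain ⟨A, -, hA⟩ := Finite.exists_le_maximal
    (p := fun A : Subgroup E => ∀ a ∈ A, ∀ b ∈ A, Commute a b) (a := ⊥)
    (by intro a ha b _; rw [mem_bot.mp ha]; exact Commute.one_left b)
  exact ⟨A, hA.prop, fun x hx =>
    hA.le_of_ge (adjoinCommuting_commute (hy := hx) hA.prop) le_adjoinCommuting
      self_mem_adjoinCommuting⟩

end Subgroup

/-- A subgroup of the character group of a finite abelian group which separates points is
the whole character group. -/
theorem Subgroup.eq_top_of_separates_points {B : Type*} [CommGroup B] [Finite B]
    (X : Subgroup (B →* ℂˣ)) (hX : ∀ b, (∀ χ ∈ X, χ b = 1) → b = 1) : X = ⊤ := by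
  have : Finite (B →* ℂˣ) := Nat.finite_of_card_ne_zero <| by
    rw [CommGroup.card_monoidHom_of_hasEnoughRootsOfUnity]; exact Nat.card_pos.ne'
  have : Finite (X →* ℂˣ) := Nat.finite_of_card_ne_zero <| by
    rw [CommGroup.card_monoidHom_of_hasEnoughRootsOfUnity]; exact Nat.card_pos.ne'
  let ev : B →* (X →* ℂˣ) := MonoidHom.mk' (fun b => (MonoidHom.eval b).comp X.subtype) (by
    intro b c; ext χ; simp)
  have hev : Function.Injective ev := by
    rw [injective_iff_map_eq_one]
    exact fun b hb => hX b fun χ hχ => DFunLike.congr_fun hb ⟨χ, hχ⟩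
  apply Subgroup.eq_top_of_le_card
  calc Nat.card (B →* ℂˣ) = Nat.card B := CommGroup.card_monoidHom_of_hasEnoughRootsOfUnity B ℂ
    _ ≤ Nat.card (X →* ℂˣ) := Nat.card_le_card_of_injective ev hev
    _ = Nat.card X := CommGroup.card_monoidHom_of_hasEnoughRootsOfUnity X ℂ

section ClassTwo

variable {E : Type*} [Group E]

theorem commutatorElement_mem_center (h : commutator E ≤ Subgroup.center E) (x y : E) :
    ⁅x, y⁆ ∈ Subgroup.center E :=
  h (Subgroup.commutator_mem_commutator (Subgroup.mem_top x) (Subgroup.mem_top y))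

/-- In a group of nilpotency class at most two, the commutator composed with a character of
the center is bimultiplicative. -/
def commutatorPairing (h : commutator E ≤ Subgroup.center E) (χ : Subgroup.center E →* ℂˣ) :
    E →* E →* ℂˣ :=
  MonoidHom.mk' (fun x => MonoidHom.mk'
    (fun y => χ ⟨⁅x, y⁆, commutatorElement_mem_center h x y⟩) (by
      intro y z
      rw [← map_mul]
      congr 1
      ext
      have := Subgroup.mem_center_iff.mp (commutatorElement_mem_center h x z) y
      simp only [Subgroup.coe_mul]
      calc ⁅x, y * z⁆ = ⁅x, y⁆ * (y * ⁅x, z⁆ * y⁻¹) := by simp only [commutatorElement_def]; group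
        _ = _ := by rw [this]; group)) (by
    intro x y
    ext z
    simp only [MonoidHom.mk'_apply, MonoidHom.mul_apply, ← map_mul]
    congr 2
    ext
    have := Subgroup.mem_center_iff.mp (commutatorElement_mem_center h y z) x
    have h2 := Subgroup.mem_center_iff.mp (commutatorElement_mem_center h y z) ⁅x, z⁆
    simp only [Subgroup.coe_mul]
    calc ⁅x * y, z⁆ = (x * ⁅y, z⁆ * x⁻¹) * ⁅x, z⁆ := by simp only [commutatorElement_def]; group
      _ = _ := by rw [this, mul_inv_cancel_right, h2])

theorem commutatorPairing_eq_one_iff (h : commutator E ≤ Subgroup.center E)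
    {χ : Subgroup.center E →* ℂˣ} (hχ : Function.Injective χ) (x y : E) :
    commutatorPairing h χ x y = 1 ↔ Commute x y := by
  change χ _ = 1 ↔ _
  rw [map_eq_one_iff χ hχ, ← commutatorElement_eq_one_iff_commute, Subgroup.mk_eq_one]

/-- A self-centralizing abelian subgroup of a finite group of prime exponent whose commutator
subgroup lies in a center with a faithful character has a complement. -/
theorem exists_complement_of_self_centralizing [Finite E] {p : ℕ} (hp : p.Prime)
    (hexp : ∀ x : E, x ^ p = 1) (h : commutator E ≤ Subgroup.center E)
    {χ : Subgroup.center E →* ℂˣ} (hχ : Function.Injective χ) (A : Subgroup E) [A.Normal]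
    (hA : ∀ x, (∀ a ∈ A, Commute a x) → x ∈ A) :
    ∃ B : Subgroup E, A ⊓ B = ⊥ ∧ A ⊔ B = ⊤ := by
  obtain ⟨B, -, hB⟩ := Finite.exists_le_maximal
    (p := fun B : Subgroup E => (∀ a ∈ B, ∀ b ∈ B, Commute a b) ∧ A ⊓ B = ⊥) (a := ⊥)
    ⟨by intro a ha b _; rw [Subgroup.mem_bot.mp ha]; exact Commute.one_left b, inf_bot_eq A⟩
  obtain ⟨hcomm, hAB⟩ := hB.prop
  refine ⟨B, hAB, eq_top_iff.mpr fun x _ => ?_⟩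
  by_contra hx
  let : CommGroup B :=
    { (inferInstance : Group B) with mul_comm := fun a b => Subtype.ext (hcomm a a.2 b b.2) }
  let Φ : E →* (B →* ℂˣ) := MonoidHom.mk' (fun x => (commutatorPairing h χ x).comp B.subtype) (by
    intro x y; ext; simp)
  have hΦ : ∀ x (b : B), Φ x b = 1 ↔ Commute x b := fun x b =>
    commutatorPairing_eq_one_iff h hχ x b
  have htop : A.map Φ = ⊤ := by
    apply Subgroup.eq_top_of_separates_points
    intro b hb
    have hbA : (b : E) ∈ A := hA _ fun a ha => (hΦ a b).mp (hb _ ⟨a, ha, rfl⟩)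
    have : (b : E) ∈ A ⊓ B := ⟨hbA, b.2⟩
    rw [hAB, Subgroup.mem_bot] at this
    exact Subtype.ext this
  obtain ⟨a, ha, hax⟩ : (Φ x)⁻¹ ∈ A.map Φ := htop ▸ Subgroup.mem_top _
  have hax' : Φ (a * x) = 1 := by
    rw [map_mul, hax]
    exact inv_mul_cancel (Φ x)
  have hy : ∀ b ∈ B, Commute b (a * x) := fun b hb =>
    ((hΦ (a * x) ⟨b, hb⟩).mp (DFunLike.congr_fun hax' ⟨b, hb⟩)).symm
  have hyAB : a * x ∉ A ⊔ B := fun hmem =>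
    hx (((A ⊔ B).mul_mem_cancel_left (Subgroup.mem_sup_left ha)).mp hmem)
  refine hyAB (Subgroup.mem_sup_right (hB.le_of_ge
    ⟨Subgroup.adjoinCommuting_commute (hy := hy) hcomm, ?_⟩
    Subgroup.le_adjoinCommuting Subgroup.self_mem_adjoinCommuting))
  rw [eq_bot_iff]
  rintro _ ⟨hgA, b, hb, i, rfl⟩
  by_cases hi : (p : ℤ) ∣ i
  · have hone : (a * x) ^ i = 1 := by
      obtain ⟨j, rfl⟩ := hi
      rw [zpow_mul, zpow_natCast, hexp, one_zpow]
    rw [hone, mul_one] at hgA ⊢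
    exact hAB ▸ Subgroup.mem_inf.mpr ⟨hgA, hb⟩
  · have hpow : (a * x) ^ i ∈ A ⊔ B :=
      ((A ⊔ B).mul_mem_cancel_left (Subgroup.mem_sup_right hb)).mp (Subgroup.mem_sup_left hgA)
    obtain ⟨u, v, huv⟩ := (Nat.prime_iff_prime_int.mp hp).coprime_iff_not_dvd.mpr hi
    refine absurd ?_ hyAB
    have : a * x = ((a * x) ^ i) ^ v := by
      conv_lhs => rw [← zpow_one (a * x), ← huv, zpow_add, mul_comm u, zpow_mul, zpow_natCast,
        hexp, one_zpow, one_mul, mul_comm, zpow_mul]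
    rw [this]
    exact zpow_mem hpow v

/-- Raising to a power coprime to the exponent on an abelian normal subgroup extends to an
automorphism when there is a complement. -/
theorem exists_mulEquiv_pow_of_complement [Finite E] {p k : ℕ}
    (hexp : ∀ x : E, x ^ p = 1) (hk : p.Coprime k) (A B : Subgroup E) [hN : A.Normal]
    (hA : ∀ a ∈ A, ∀ b ∈ A, Commute a b) (hinf : A ⊓ B = ⊥) (hsup : A ⊔ B = ⊤) :
    ∃ γ : E ≃* E, ∀ a ∈ A, γ a = a ^ k := by
  have hdec : ∀ x : E, ∃ a b, a ∈ A ∧ b ∈ B ∧ a * b = x := fun x => by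
    have hx : x ∈ A ⊔ B := hsup ▸ Subgroup.mem_top x
    obtain ⟨a, ha, b, hb, h⟩ := Subgroup.mem_sup_of_normal_left.mp hx
    exact ⟨a, b, ha, hb, h⟩
  have hone : ∀ x, x ∈ A → x ∈ B → x = 1 := fun x hxA hxB =>
    Subgroup.mem_bot.mp (hinf ▸ Subgroup.mem_inf.mpr ⟨hxA, hxB⟩)
  have huniq : ∀ a ∈ A, ∀ b ∈ B, ∀ a' ∈ A, ∀ b' ∈ B, a * b = a' * b' → a = a' ∧ b = b' := by
    intro a ha b hb a' ha' b' hb' heq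
    have h1 : a'⁻¹ * a = b' * b⁻¹ := by
      rw [inv_mul_eq_iff_eq_mul, ← mul_assoc, ← heq, mul_inv_cancel_right]
    have h2 := hone _ (A.mul_mem (A.inv_mem ha') ha) (h1 ▸ B.mul_mem hb' (B.inv_mem hb))
    exact ⟨(inv_mul_eq_one.mp h2).symm, (mul_inv_eq_one.mp (h1 ▸ h2)).symm⟩
  choose α β hα hβ hαβ using hdec
  have hmul : ∀ a ∈ A, ∀ b ∈ B, α (a * b) = a ∧ β (a * b) = b := fun a ha b hb =>
    huniq _ (hα _) _ (hβ _) a ha b hb (hαβ _)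
  let f : E →* E := MonoidHom.mk' (fun x => α x ^ k * β x) (by
    intro x y
    have hconj := hN.conj_mem _ (hα y) (β x)
    have hxy : x * y = (α x * (β x * α y * (β x)⁻¹)) * (β x * β y) := by
      conv_lhs => rw [← hαβ x, ← hαβ y]
      group
    obtain ⟨h1, h2⟩ := hmul _ (A.mul_mem (hα x) hconj) _ (B.mul_mem (hβ x) (hβ y))
    rw [← hxy] at h1 h2
    rw [h1, h2, (hA _ (hα x) _ hconj).mul_pow, conj_pow]
    group)
  have hf : Function.Injective f := by
    rw [injective_iff_map_eq_one]
    intro x hx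
    replace hx : α x ^ k * β x = 1 * 1 := by rw [mul_one]; exact hx
    obtain ⟨h1, h2⟩ := huniq _ (A.pow_mem (hα x) k) _ (hβ x) _ A.one_mem _ B.one_mem hx
    have h3 : α x = 1 := by
      have := Nat.dvd_gcd (orderOf_dvd_of_pow_eq_one (hexp (α x))) (orderOf_dvd_of_pow_eq_one h1)
      rwa [hk.gcd_eq_one, Nat.dvd_one, orderOf_eq_one_iff] at this
    rw [← hαβ x, h2, h3, mul_one]
  refine ⟨MulEquiv.ofBijective f (Finite.injective_iff_bijective.mp hf), fun a ha => ?_⟩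
  obtain ⟨h1, h2⟩ := hmul a ha 1 B.one_mem
  rw [mul_one] at h1 h2
  change α a ^ k * β a = a ^ k
  rw [h1, h2, mul_one]

/-- A finite group of prime exponent and class at most two whose center has a faithful character
admits automorphisms acting on the center by any power coprime to the exponent. -/
theorem exists_mulEquiv_pow_on_center [Finite E] {p k : ℕ} (hp : p.Prime)
    (hexp : ∀ x : E, x ^ p = 1) (h : commutator E ≤ Subgroup.center E)
    {χ : Subgroup.center E →* ℂˣ} (hχ : Function.Injective χ) (hk : p.Coprime k) :
    ∃ γ : E ≃* E, ∀ z ∈ Subgroup.center E, γ z = z ^ k := by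
  obtain ⟨A, hAcomm, hA⟩ := Subgroup.exists_commute_self_centralizing E
  have hZA : Subgroup.center E ≤ A := fun z hz => hA z fun a _ => Subgroup.mem_center_iff.mp hz a
  have : A.Normal := ⟨fun a ha g => by
    have : g * a * g⁻¹ = ⁅g, a⁆ * a := by rw [commutatorElement_def]; group
    rw [this]
    exact A.mul_mem (hZA (commutatorElement_mem_center h g a)) ha⟩
  obtain ⟨B, hinf, hsup⟩ := exists_complement_of_self_centralizing hp hexp h hχ A hA
  obtain ⟨γ, hγ⟩ := exists_mulEquiv_pow_of_complement hexp hk A B hAcomm hinf hsup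
  exact ⟨γ, fun z hz => hγ z (hZA hz)⟩

end ClassTwo

/-- Two injective characters of a group of prime order differ by a power coprime to the order. -/
theorem exists_coprime_pow_eq_of_injective {Z : Type*} [Group Z] {p : ℕ} (hp : p.Prime)
    (hcard : Nat.card Z = p) {χ χ' : Z →* ℂˣ} (hχ : Function.Injective χ)
    (hχ' : Function.Injective χ') :
    ∃ k, p.Coprime k ∧ ∀ z, χ (z ^ k) = χ' z := by
  have : Fact p.Prime := ⟨hp⟩
  have : IsCyclic Z := isCyclic_of_prime_card hcard
  obtain ⟨g, hg⟩ := IsCyclic.exists_ofOrder_eq_natCard (α := Z)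
  rw [hcard] at hg
  have hprim : IsPrimitiveRoot (χ g) p := by
    rw [← hg, ← orderOf_injective χ hχ g]
    exact IsPrimitiveRoot.orderOf _
  have hpow : χ' g ^ p = 1 := by rw [← map_pow, ← hg, pow_orderOf_eq_one, map_one]
  have : NeZero p := ⟨hp.ne_zero⟩
  obtain ⟨k, hk⟩ : ∃ k : ℕ, χ g ^ k = χ' g := by
    obtain ⟨k, -, hk⟩ := (hprim.map_of_injective Units.coeHom_injective).eq_pow_of_pow_eq_one
      (ξ := (χ' g : ℂ)) (by rw [← Units.val_pow_eq_pow_val, hpow, Units.val_one])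
    exact ⟨k, Units.ext (by simpa using hk)⟩
  refine ⟨k, (hp.coprime_iff_not_dvd).mpr fun hdvd => ?_, fun z => ?_⟩
  · have h1 : χ' g = 1 := by
      obtain ⟨j, rfl⟩ := hdvd
      rw [← hk, pow_mul, hprim.pow_eq_one, one_pow]
    rw [map_eq_one_iff χ' hχ'] at h1
    rw [h1, orderOf_one] at hg
    exact hp.one_lt.ne hg
  · have hz : z ∈ Subgroup.zpowers g := by
      have : Subgroup.zpowers g = ⊤ := by
        have : Finite Z := Nat.finite_of_card_ne_zero (hcard ▸ hp.ne_zero)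
        exact Subgroup.eq_top_of_card_eq _ (by rw [Nat.card_zpowers, hg, hcard])
      exact this ▸ Subgroup.mem_top z
    obtain ⟨i, rfl⟩ := hz
    simp only [map_pow, map_zpow, ← hk]
    rw [← zpow_natCast, ← zpow_natCast, zpow_comm]

namespace Representation

variable {E W W' : Type*} [Group E] [AddCommGroup W] [Module ℂ W] [AddCommGroup W'] [Module ℂ W']

theorem isIrreducible_of_forall_submodule [Nontrivial W] (D : Representation ℂ E W)
    (hirr : ∀ U : Submodule ℂ W, (∀ e : E, U.map (D e) ≤ U) → U = ⊥ ∨ U = ⊤) :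
    IsIrreducible D := by
  have : Nontrivial (Subrepresentation D) := by
    refine ⟨⊥, ⊤, fun h => ?_⟩
    exact bot_ne_top (α := Submodule ℂ W) (congrArg Subrepresentation.toSubmodule h)
  refine ⟨fun U => ?_⟩
  rcases hirr U.toSubmodule (fun e => Submodule.map_le_iff_le_comap.mpr fun v hv =>
    U.apply_mem_toSubmodule e hv) with h | h
  · exact Or.inl (Subrepresentation.toSubmodule_injective h)
  · exact Or.inr (Subrepresentation.toSubmodule_injective h)

/-- The center acts on an irreducible representation through a character. -/
theorem exists_central_character [FiniteDimensional ℂ W] [Nontrivial W]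
    (D : Representation ℂ E W)
    (hirr : ∀ U : Submodule ℂ W, (∀ e : E, U.map (D e) ≤ U) → U = ⊥ ∨ U = ⊤) :
    ∃ χ : Subgroup.center E →* ℂˣ, ∀ (z : Subgroup.center E) w, D z w = (χ z : ℂ) • w := by
  have hscalar : ∀ z : Subgroup.center E, ∃ c : ℂ, ∀ w, D z w = c • w := fun z => by
    obtain ⟨c, hc⟩ := Module.End.exists_eigenvalue (D z)
    refine ⟨c, fun w => ?_⟩
    have htop := (hirr (Module.End.eigenspace (D z) c) fun e => by
      rintro _ ⟨v, hv, rfl⟩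
      rw [SetLike.mem_coe, Module.End.mem_eigenspace_iff] at hv
      rw [Module.End.mem_eigenspace_iff, ← Module.End.mul_apply, ← map_mul,
        ← Subgroup.mem_center_iff.mp z.2 e, map_mul, Module.End.mul_apply, hv,
        map_smul]).resolve_left hc
    exact Module.End.mem_eigenspace_iff.mp (htop ▸ Submodule.mem_top)
  choose c hc using hscalar
  obtain ⟨w, hw⟩ := exists_ne (0 : W)
  let ψ : Subgroup.center E →* ℂ :=
    { toFun := c
      map_one' := smul_left_injective ℂ hw (by simp [← hc])
      map_mul' := fun x y => smul_left_injective ℂ hw (by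
        simp only [mul_smul, ← hc, Subgroup.coe_mul, map_mul, Module.End.mul_apply]) }
  exact ⟨ψ.toHomUnits, fun z w => hc z w⟩

theorem central_character_injective {D : Representation ℂ E W} (hfaith : Function.Injective D)
    {χ : Subgroup.center E →* ℂˣ} (hχ : ∀ (z : Subgroup.center E) w, D z w = (χ z : ℂ) • w) :
    Function.Injective χ := fun x y hxy =>
  Subtype.ext (hfaith (LinearMap.ext fun w => by rw [hχ, hχ, hxy]))

/-- In class at most two, the character of a representation with faithful central character
vanishes off the center. -/
theorem character_eq_zero_of_notMem_center (h : commutator E ≤ Subgroup.center E)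
    {D : Representation ℂ E W} {χ : Subgroup.center E →* ℂˣ} (hinj : Function.Injective χ)
    (hχ : ∀ (z : Subgroup.center E) w, D z w = (χ z : ℂ) • w) {e : E} (he : e ∉ Subgroup.center E) :
    D.character e = 0 := by
  obtain ⟨f, hf⟩ : ∃ f, f * e ≠ e * f := by
    simpa [Subgroup.mem_center_iff] using he
  let z : Subgroup.center E := ⟨⁅f, e⁆, commutatorElement_mem_center h f e⟩
  have hz : χ z ≠ 1 := by
    rw [Ne, map_eq_one_iff χ hinj, Subgroup.mk_eq_one, commutatorElement_eq_one_iff_mul_comm]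
    exact hf
  have h1 : D.character e = (χ z : ℂ) * D.character e := by
    have h2 : D (f * e * f⁻¹) = (χ z : ℂ) • D e := by
      ext w
      have : f * e * f⁻¹ = z * e := by simp [z, commutatorElement_def]
      rw [this, map_mul, Module.End.mul_apply, hχ, LinearMap.smul_apply]
    calc D.character e = D.character (f * e * f⁻¹) := (D.char_conj e f).symm
      _ = _ := by rw [character, h2, map_smul, smul_eq_mul, character]
  by_contra h0
  exact hz (Units.ext (mul_right_cancel₀ h0 (by rw [← h1, Units.val_one, one_mul])))

theorem character_of_central [FiniteDimensional ℂ W] {D : Representation ℂ E W} {χ : Subgroup.center E →* ℂˣ}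
    (hχ : ∀ (z : Subgroup.center E) w, D z w = (χ z : ℂ) • w) (z : Subgroup.center E) :
    D.character z = χ z * Module.finrank ℂ W := by
  have : D z = (χ z : ℂ) • (1 : Module.End ℂ W) := LinearMap.ext (hχ z)
  rw [character, this, map_smul, LinearMap.trace_one, smul_eq_mul]

/-- In class at most two, irreducible representations are determined by a faithful central
character. -/
theorem nonempty_equiv_of_central_character [Finite E] [FiniteDimensional ℂ W]
    [FiniteDimensional ℂ W'] [Nontrivial W] [Nontrivial W']
    (h : commutator E ≤ Subgroup.center E) {D : Representation ℂ E W}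
    {D' : Representation ℂ E W'} [IsIrreducible D] [IsIrreducible D']
    {χ : Subgroup.center E →* ℂˣ} (hinj : Function.Injective χ)
    (hχ : ∀ (z : Subgroup.center E) w, D z w = (χ z : ℂ) • w) (hχ' : ∀ (z : Subgroup.center E) w, D' z w = (χ z : ℂ) • w) :
    Nonempty (Equiv D D') := by
  classical
  have := Fintype.ofFinite E
  have hE : (Nat.card E : ℂ) ≠ 0 := Nat.cast_ne_zero.mpr Nat.card_pos.ne'
  have : Invertible (Nat.card E : ℂ) := invertibleOfNonzero hE
  have horth := char_orthonormal D' D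
  by_contra hne
  rw [if_neg hne, mul_eq_zero, or_iff_right (inv_ne_zero hE)] at horth
  have hterm : ∀ e, D'.character e * D.character e⁻¹ =
      if e ∈ Subgroup.center E then (Module.finrank ℂ W' * Module.finrank ℂ W : ℂ) else 0 := by
    intro e
    split_ifs with he
    · have h1 := character_of_central hχ' ⟨e, he⟩
      have h2 := character_of_central hχ (⟨e, he⟩⁻¹)
      rw [Subgroup.coe_inv] at h2
      rw [h1, h2, map_inv, mul_mul_mul_comm, Units.mul_inv, one_mul]
    · rw [character_eq_zero_of_notMem_center h hinj hχ' he, zero_mul]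
  rw [Finset.sum_congr rfl fun e _ => hterm e, ← Finset.sum_filter, Finset.sum_const,
    nsmul_eq_mul] at horth
  refine mul_ne_zero ?_ (mul_ne_zero ?_ ?_) horth
  · exact Nat.cast_ne_zero.mpr (Finset.card_ne_zero_of_mem (a := 1) (by simp [one_mem]))
  · exact Nat.cast_ne_zero.mpr Module.finrank_pos.ne'
  · exact Nat.cast_ne_zero.mpr Module.finrank_pos.ne'

end Representation

theorem faithful_irreducible_reps_conjugate_by_automorphism
    (p : ℕ) (hp : p.Prime) (hodd : Odd p) (m : ℕ) (hm : 1 ≤ m)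
    (E : Type) [Group E] [Finite E]
    (hE : IsExtraspecial p E)
    (hcard : Nat.card E = p ^ (1 + 2 * m))
    (hexp : ∀ x : E, x ^ p = 1)
    (W W' : Type) [AddCommGroup W] [Module ℂ W] [FiniteDimensional ℂ W]
    [AddCommGroup W'] [Module ℂ W'] [FiniteDimensional ℂ W']
    (D : Representation ℂ E W) (D' : Representation ℂ E W')
    (hfaith : Function.Injective D) (hfaith' : Function.Injective D')
    (hnt : Nontrivial W) (hnt' : Nontrivial W')
    (hirr : ∀ U : Submodule ℂ W, (∀ e : E, U.map (D e) ≤ U) → U = ⊥ ∨ U = ⊤)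
    (hirr' : ∀ U : Submodule ℂ W', (∀ e : E, U.map (D' e) ≤ U) → U = ⊥ ∨ U = ⊤) :
    ∃ γ : E ≃* E, ∃ φ : W ≃ₗ[ℂ] W',
      ∀ (e : E) (w : W), φ (D (γ e) w) = D' e (φ w) := by
  obtain ⟨hZ, hcomm, -, -⟩ := hE
  obtain ⟨χ, hχ⟩ := D.exists_central_character hirr
  obtain ⟨χ', hχ'⟩ := D'.exists_central_character hirr'
  have hinj := Representation.central_character_injective hfaith hχ
  have hinj' := Representation.central_character_injective hfaith' hχ'
  obtain ⟨k, hk, hpow⟩ := exists_coprime_pow_eq_of_injective hp hZ hinj hinj'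
  obtain ⟨γ, hγ⟩ := exists_mulEquiv_pow_on_center hp hexp hcomm.le hinj hk
  let Dγ : Representation ℂ E W := D.comp γ.toMonoidHom
  have hirrγ : ∀ U : Submodule ℂ W, (∀ e : E, U.map (Dγ e) ≤ U) → U = ⊥ ∨ U = ⊤ :=
    fun U hU => hirr U fun e => by
      have := hU (γ.symm e)
      rwa [show Dγ (γ.symm e) = D e from congrArg D (γ.apply_symm_apply e)] at this
  have := Representation.isIrreducible_of_forall_submodule Dγ hirrγ
  have := Representation.isIrreducible_of_forall_submodule D' hirr'
  have hχγ : ∀ (z : Subgroup.center E) w, Dγ z w = (χ' z : ℂ) • w := fun z w => by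
    rw [← hpow, ← hχ, Subgroup.coe_pow, ← hγ z z.2]
    rfl
  obtain ⟨φ⟩ := Representation.nonempty_equiv_of_central_character hcomm.le hinj' hχγ hχ'
  exact ⟨γ, φ.toLinearEquiv, fun e w =>
    LinearMap.congr_fun (φ.toIntertwiningMap.isIntertwining' e) w⟩
end
end

section
/- Let m ≥ 1 and let E be a finite 2-group of order 2^(2m+2) whose center Z(E) is cyclic of order 4, whose commutator subgroup [E,E] has order 2, and for which E/Z(E) is elementary abelian of order 2^(2m) (i.e., E is the central product of an extraspecial group of order 2^(1+2m) with a cyclic group of order 4). Then E has, up to isomorphism, exactly two faithful finite-dimensional irreducible complex representations; each has dimension 2^m, and they send a fixed generator z of Z(E) to i·(identity) and to −i·(identity) respectively. Moreover, every faithful irreducible complex representation of E is one of these two. -/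
open Module

noncomputable section

open scoped commutatorElement

/-- A vector of a complex vector space equal to its opposite is zero. -/
theorem eq_zero_of_eq_neg_self {V : Type*} [AddCommGroup V] [Module ℂ V] {v : V} (h : v = -v) :
    v = 0 := by
  have h2 : (2 : ℂ) • v = 0 := by rw [two_smul]; exact add_eq_zero_iff_eq_neg.2 h
  simpa using h2

namespace CRep

variable {E : Type} [Group E]

/-- Irreducibility in the sense of `CRep` agrees with Mathlib's notion. -/
theorem Irreducible.isIrreducible_s16 {R : CRep E} (h : R.Irreducible) : R.ρ.IsIrreducible := by
  obtain ⟨hn, hU⟩ := h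
  have hnt : Nontrivial (Subrepresentation R.ρ) := by
    refine ⟨⊥, ⊤, fun heq ↦ ?_⟩
    have : (⊥ : Submodule ℂ R.W) = ⊤ := congrArg Subrepresentation.toSubmodule heq
    exact bot_ne_top this
  refine ⟨fun σ ↦ ?_⟩
  have hσ : ∀ e : E, σ.toSubmodule.map (R.ρ e) ≤ σ.toSubmodule := by
    rintro e _ ⟨w, hw, rfl⟩
    exact σ.apply_mem_toSubmodule e hw
  exact (hU σ.toSubmodule hσ).imp (fun h ↦ Subrepresentation.toSubmodule_injective h)
    fun h ↦ Subrepresentation.toSubmodule_injective h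

/-- A scalar eigenspace of a central element of a finite-dimensional representation contains an
irreducible subrepresentation as soon as it is nonzero. -/
theorem exists_irreducible_of_eigenvector {V : Type} [AddCommGroup V] [Module ℂ V]
    [FiniteDimensional ℂ V] (ρ : Representation ℂ E V) {z : E} (hz : z ∈ Subgroup.center E)
    {μ : ℂ} {v : V} (hv : v ≠ 0) (hzv : ρ z v = μ • v) :
    ∃ R : CRep E, FiniteDimensional ℂ R.W ∧ R.Irreducible ∧ ∀ w : R.W, R.ρ z w = μ • w := by
  let S : Set (Submodule ℂ V) :=
    {U | U ≠ ⊥ ∧ (∀ e, ∀ w ∈ U, ρ e w ∈ U) ∧ ∀ w ∈ U, ρ z w = μ • w}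
  have hS : S.Nonempty := by
    refine ⟨Module.End.eigenspace (ρ z) μ, ?_, ?_, ?_⟩
    · exact (Submodule.ne_bot_iff _).2 ⟨v, Module.End.mem_eigenspace_iff.2 hzv, hv⟩
    · intro e w hw
      rw [Module.End.mem_eigenspace_iff] at hw ⊢
      rw [← Module.End.mul_apply, ← map_mul, ← Subgroup.mem_center_iff.1 hz e, map_mul,
        Module.End.mul_apply, hw, map_smul]
    · exact fun w hw ↦ Module.End.mem_eigenspace_iff.1 hw
  obtain ⟨U, ⟨hU0, hUinv, hUz⟩, hmin⟩ := WellFounded.has_min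
    (wellFounded_lt : WellFounded ((· < ·) : Submodule ℂ V → Submodule ℂ V → Prop)) S hS
  let σ : Subrepresentation ρ := ⟨U, fun e w hw ↦ hUinv e w hw⟩
  refine ⟨⟨U, σ.toRepresentation⟩, inferInstanceAs (FiniteDimensional ℂ U), ⟨?_, ?_⟩, ?_⟩
  · exact Submodule.nontrivial_iff_ne_bot.2 hU0
  · intro (N : Submodule ℂ U) hN
    by_contra! hne
    have hmap : N.map U.subtype ∈ S := by
      refine ⟨?_, ?_, ?_⟩
      · refine fun h ↦ hne.1 (Submodule.map_injective_of_injective U.injective_subtype ?_)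
        rw [h, Submodule.map_bot]
      · rintro e _ ⟨w, hw, rfl⟩
        exact ⟨_, hN e ⟨w, hw, rfl⟩, rfl⟩
      · rintro _ ⟨w, -, rfl⟩
        exact hUz _ w.2
    refine hmin _ hmap (lt_of_le_of_ne (Submodule.map_subtype_le U N) fun h ↦ hne.2 ?_)
    apply Submodule.map_injective_of_injective U.injective_subtype
    rw [h, Submodule.map_subtype_top]
  · exact fun w ↦ Subtype.ext (hUz _ w.2)

/-- The representation of `E` on functions by right translation. -/
def rightTranslation (E : Type) [Group E] : Representation ℂ E (E → ℂ) where
  toFun g := LinearMap.funLeft ℂ ℂ (· * g)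
  map_one' := by ext; simp [LinearMap.funLeft]
  map_mul' g h := by
    refine LinearMap.ext fun f ↦ funext fun x ↦ ?_
    simp [LinearMap.funLeft_apply, mul_assoc]

/-- A central element of order four acts on some irreducible representation by any prescribed
fourth root of unity. -/
theorem exists_irreducible_of_orderOf_eq_four [Finite E] {z : E} (hz : z ∈ Subgroup.center E)
    (hord : orderOf z = 4) {μ : ℂ} (hμ : μ ^ 4 = 1) :
    ∃ R : CRep E, FiniteDimensional ℂ R.W ∧ R.Irreducible ∧ ∀ w : R.W, R.ρ z w = μ • w := by
  classical
  have h4 : z ^ 4 = 1 := hord ▸ pow_orderOf_eq_one z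
  have hne : ∀ k, 0 < k → k < 4 → z ^ k ≠ 1 := fun k h0 hk ↦
    pow_ne_one_of_lt_orderOf h0.ne' (hord ▸ hk)
  have h1 : z ≠ 1 := pow_one z ▸ hne 1 (by norm_num) (by norm_num)
  have h2 := hne 2 (by norm_num) (by norm_num)
  have h3 := hne 3 (by norm_num) (by norm_num)
  have hμ0 : μ ≠ 0 := by rintro rfl; norm_num at hμ
  let δ : E → ℂ := Pi.single 1 1
  let f : E → ℂ := fun x ↦ δ (x * z ^ 3) + μ * δ (x * z ^ 2) + μ ^ 2 * δ (x * z) + μ ^ 3 * δ x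
  refine exists_irreducible_of_eigenvector (rightTranslation E) hz (μ := μ) (v := f) ?_ ?_
  · intro hf
    have : f 1 = 0 := congrFun hf 1
    simp only [f, δ, one_mul, Pi.single_apply, h1, h2, h3, if_false, if_true] at this
    simp [hμ0] at this
  · funext x
    have e3 : x * z * z ^ 3 = x := by rw [mul_assoc, ← pow_succ', h4, mul_one]
    have e2 : x * z * z ^ 2 = x * z ^ 3 := by rw [mul_assoc, ← pow_succ']
    have e1 : x * z * z = x * z ^ 2 := by rw [mul_assoc, ← sq]
    change f (x * z) = μ * f x
    simp only [f, e1, e2, e3]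
    linear_combination (-δ x) * hμ

/-- By Schur's lemma, a central element acts as a scalar on an irreducible representation. -/
theorem Irreducible.exists_smul {R : CRep E} [FiniteDimensional ℂ R.W] (h : R.Irreducible)
    {z : E} (hz : z ∈ Subgroup.center E) : ∃ μ : ℂ, ∀ w, R.ρ z w = μ • w := by
  have := h.1
  obtain ⟨μ, hμ⟩ := Module.End.exists_eigenvalue (R.ρ z)
  refine ⟨μ, fun w ↦ ?_⟩
  have htop : Module.End.eigenspace (R.ρ z) μ = ⊤ := by
    refine (h.2 _ ?_).resolve_left hμ
    rintro e _ ⟨w, hw, rfl⟩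
    have hw' := Module.End.mem_eigenspace_iff.1 hw
    rw [Module.End.mem_eigenspace_iff, ← Module.End.mul_apply, ← map_mul,
      ← Subgroup.mem_center_iff.1 hz e, map_mul, Module.End.mul_apply, hw', map_smul]
  exact Module.End.mem_eigenspace_iff.1 (htop ▸ Submodule.mem_top)

theorem pow_apply_of_smul {R : CRep E} {z : E} {μ : ℂ} (hz : ∀ w, R.ρ z w = μ • w) (k : ℕ) :
    R.ρ (z ^ k) = μ ^ k • LinearMap.id := by
  have : R.ρ z = μ • 1 := LinearMap.ext hz
  rw [map_pow, this, smul_pow, one_pow]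
  rfl

/-- The pairing of the characters of two representations with the same central character, when
every non-central element is conjugate to its product with an element acting as `-1`. -/
theorem sum_character_mul_character_inv [Fintype E] {R R' : CRep E} [FiniteDimensional ℂ R.W]
    [FiniteDimensional ℂ R'.W] {z : E} {μ : ℂ}
    (hμ : μ ^ 2 = -1)
    (hz : Subgroup.zpowers z = Subgroup.center E)
    (hconj : ∀ x ∉ Subgroup.center E, ∃ y, y * x * y⁻¹ = z ^ 2 * x)
    (hR : ∀ w, R.ρ z w = μ • w) (hR' : ∀ w, R'.ρ z w = μ • w) :
    ∑ g : E, R.ρ.character g * R'.ρ.character g⁻¹ =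
      Nat.card (Subgroup.center E) * (finrank ℂ R.W * finrank ℂ R'.W) := by
  classical
  have hμ0 : μ ≠ 0 := by rintro rfl; norm_num at hμ
  have key : ∀ g : E, R.ρ.character g * R'.ρ.character g⁻¹ =
      if g ∈ Subgroup.center E then (finrank ℂ R.W * finrank ℂ R'.W : ℂ) else 0 := by
    intro g
    split_ifs with hg
    · obtain ⟨k, rfl⟩ := (mem_powers_iff_mem_zpowers (x := z)).2 (hz ▸ hg)
      have hinv : R'.ρ (z ^ k)⁻¹ = (μ ^ k)⁻¹ • LinearMap.id := by
        have h1 : R'.ρ (z ^ k)⁻¹ * R'.ρ (z ^ k) = 1 := by rw [← map_mul]; simp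
        rw [pow_apply_of_smul hR' k] at h1
        refine LinearMap.ext fun w ↦ ?_
        have := LinearMap.congr_fun h1 ((μ ^ k)⁻¹ • w)
        simpa [smul_smul, hμ0] using this
      simp only [Representation.character, hinv, pow_apply_of_smul hR k, map_smul, smul_eq_mul]
      field_simp
      rw [LinearMap.trace_id, LinearMap.trace_id]
    · obtain ⟨y, hy⟩ := hconj g hg
      have h1 : R.ρ.character g = -R.ρ.character g := by
        conv_lhs => rw [← R.ρ.char_conj g y, hy, Representation.character, map_mul, pow_apply_of_smul hR, hμ]
        simp [Representation.character, Module.End.mul_eq_comp]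
      rw [self_eq_neg.1 h1, zero_mul]
  rw [Finset.sum_congr rfl fun g _ ↦ key g, ← Finset.sum_filter, Finset.sum_const, nsmul_eq_mul,
    Nat.card_eq_fintype_card, Fintype.card_subtype]

/-- A representation in which the square of a generator of the center acts as `-1` is injective,
when every non-central element is conjugate to its product with that square. -/
theorem injective_of_smul {R : CRep E} [Nontrivial R.W] [Finite E] {z : E} {μ : ℂ} (hμ : μ ^ 2 = -1)
    (hz : Subgroup.zpowers z = Subgroup.center E) (hord : orderOf z = 4)
    (hconj : ∀ x ∉ Subgroup.center E, ∃ y, y * x * y⁻¹ = z ^ 2 * x)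
    (hR : ∀ w, R.ρ z w = μ • w) : Function.Injective R.ρ := by
  obtain ⟨w, hw⟩ := exists_ne (0 : R.W)
  have h2 : R.ρ (z ^ 2) ≠ 1 := by
    rw [pow_apply_of_smul hR, hμ]
    intro h
    have := LinearMap.congr_fun h w
    exact hw (eq_zero_of_eq_neg_self (by simpa using this.symm))
  refine (injective_iff_map_eq_one (R.ρ : E →* _)).2 fun x hx ↦ ?_
  by_cases hxc : x ∈ Subgroup.center E
  · obtain ⟨k, rfl⟩ := (mem_powers_iff_mem_zpowers (x := z)).2 (hz ▸ hxc)
    simp only [] at hx ⊢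
    have hk : μ ^ k = 1 := by
      rw [pow_apply_of_smul hR] at hx
      have := LinearMap.congr_fun hx w
      have h0 : (μ ^ k - 1) • w = 0 := by rw [sub_smul, one_smul]; simpa [sub_eq_zero] using this
      exact sub_eq_zero.1 ((smul_eq_zero.1 h0).resolve_right hw)
    have hμord : orderOf μ = 2 ^ (1 + 1) :=
      orderOf_eq_prime_pow (by rw [pow_one, hμ]; norm_num) (by
        rw [show (2 : ℕ) ^ (1 + 1) = 2 * 2 from rfl, pow_mul, hμ]; norm_num)
    rw [← orderOf_dvd_iff_pow_eq_one, hord]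
    simpa [hμord] using orderOf_dvd_of_pow_eq_one hk
  · obtain ⟨y, hy⟩ := hconj x hxc
    refine absurd ?_ h2
    have := congrArg R.ρ hy
    rw [map_mul, map_mul, hx, mul_one, ← map_mul, mul_inv_cancel, map_one, map_mul, hx,
      mul_one] at this
    exact this.symm

end CRep

/-- If the commutator subgroup has order two, the quotient by the center has exponent two and the
center is generated by an element `z` of order four, then every non-central element is conjugate to
its product with `z ^ 2`. -/
theorem exists_conj_eq_sq_mul {E : Type} [Group E] [Finite E] (hcomm : Nat.card (commutator E) = 2)
    (hquotexp : ∀ x : E ⧸ Subgroup.center E, x ^ 2 = 1) {z : E}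
    (hz : Subgroup.zpowers z = Subgroup.center E) (hord : orderOf z = 4) {x : E}
    (hx : x ∉ Subgroup.center E) : ∃ y, y * x * y⁻¹ = z ^ 2 * x := by
  obtain ⟨y, hy⟩ : ∃ y, y * x ≠ x * y := by simpa [Subgroup.mem_center_iff] using hx
  refine ⟨y, ?_⟩
  have hc : ⁅y, x⁆ ∈ commutator E :=
    Subgroup.commutator_mem_commutator (Subgroup.mem_top y) (Subgroup.mem_top x)
  have hc1 : ⁅y, x⁆ ≠ 1 := fun h ↦ hy (commutatorElement_eq_one_iff_mul_comm.1 h)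
  have hc2 : ⁅y, x⁆ ^ 2 = 1 := by
    have := pow_card_eq_one' (x := (⟨_, hc⟩ : commutator E))
    rw [hcomm] at this
    exact congrArg Subtype.val this
  have hcz : ⁅y, x⁆ ∈ Subgroup.center E := by
    rw [← QuotientGroup.eq_one_iff]
    have hcom : (y : E ⧸ Subgroup.center E) * x = x * y := by
      calc (y : E ⧸ Subgroup.center E) * x = y * x * (x * y) ^ 2 := by rw [hquotexp, mul_one]
        _ = y * x ^ 2 * y * x * y := by simp only [sq, mul_assoc]
        _ = x * y := by rw [hquotexp, mul_one, ← sq, hquotexp, one_mul]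
    exact commutatorElement_eq_one_iff_mul_comm.2 hcom
  obtain ⟨k, hk⟩ := (mem_powers_iff_mem_zpowers (x := z)).2 (hz ▸ hcz)
  simp only [] at hk
  rw [← hk] at hc1 hc2
  rw [← pow_mul, ← orderOf_dvd_iff_pow_eq_one, hord] at hc2
  obtain ⟨l, rfl⟩ : 2 ∣ k := by omega
  rw [← pow_mod_orderOf, hord] at hk hc1
  have hmod : 2 * l % 4 = 2 := by
    rcases (by omega : 2 * l % 4 = 0 ∨ 2 * l % 4 = 2) with h | h
    · exact absurd (by rw [h, pow_zero]) hc1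
    · exact h
  rw [hmod] at hk
  rw [hk, commutatorElement_def, inv_mul_cancel_right]

theorem central_product_two_faithful_irreducibles
    (m : ℕ) (hm : 1 ≤ m)
    (E : Type) [Group E] [Finite E]
    (hcard : Nat.card E = 2 ^ (2 * m + 2))
    -- `Z(E)` is cyclic of order 4
    (hZcyc : IsCyclic (Subgroup.center E))
    (hZcard : Nat.card (Subgroup.center E) = 4)
    -- `[E,E]` has order 2
    (hcomm : Nat.card (commutator E) = 2)
    -- `E/Z(E)` is elementary abelian of order `2^(2m)`
    (hquotcard : Nat.card (E ⧸ Subgroup.center E) = 2 ^ (2 * m))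
    (hquotexp : ∀ x : E ⧸ Subgroup.center E, x ^ 2 = 1)
    -- a fixed generator `z` of the center
    (z : E) (hz : Subgroup.zpowers z = Subgroup.center E) :
    ∃ R₁ R₂ : CRep E,
      FiniteDimensional ℂ R₁.W ∧ FiniteDimensional ℂ R₂.W ∧
      R₁.Irreducible ∧ R₂.Irreducible ∧
      Function.Injective R₁.ρ ∧ Function.Injective R₂.ρ ∧
      finrank ℂ R₁.W = 2 ^ m ∧ finrank ℂ R₂.W = 2 ^ m ∧
      (∀ w : R₁.W, R₁.ρ z w = Complex.I • w) ∧
      (∀ w : R₂.W, R₂.ρ z w = (-Complex.I) • w) ∧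
      ¬ RepIso R₁ R₂ ∧
      -- every faithful irreducible complex representation of `E` is one of these two
      (∀ R : CRep E, FiniteDimensional ℂ R.W → R.Irreducible →
        Function.Injective R.ρ → RepIso R R₁ ∨ RepIso R R₂) := by
  classical
  have := Fintype.ofFinite E
  have hcardC : (Nat.card E : ℂ) ≠ 0 := by simp
  let _ : Invertible (Nat.card E : ℂ) := invertibleOfNonzero hcardC
  have hzc : z ∈ Subgroup.center E := hz ▸ Subgroup.mem_zpowers z
  have hord : orderOf z = 4 := by rw [← Nat.card_zpowers, hz, hZcard]
  have hconj : ∀ x ∉ Subgroup.center E, ∃ y, y * x * y⁻¹ = z ^ 2 * x := fun x hx ↦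
    exists_conj_eq_sq_mul hcomm hquotexp hz hord hx
  have hpair : ∀ (R R' : CRep E) (μ : ℂ), μ ^ 2 = -1 → R.Irreducible → R'.Irreducible →
      FiniteDimensional ℂ R.W → FiniteDimensional ℂ R'.W →
      (∀ w, R.ρ z w = μ • w) → (∀ w, R'.ρ z w = μ • w) →
      RepIso R R' ∧ finrank ℂ R.W = 2 ^ m := by
    have hiso : ∀ (R R' : CRep E) (μ : ℂ), μ ^ 2 = -1 → R.Irreducible → R'.Irreducible →
        FiniteDimensional ℂ R.W → FiniteDimensional ℂ R'.W →
        (∀ w, R.ρ z w = μ • w) → (∀ w, R'.ρ z w = μ • w) →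
        Nonempty (Representation.Equiv R.ρ R'.ρ) ∧
          (Nat.card E : ℂ)⁻¹ * (4 * (finrank ℂ R.W * finrank ℂ R'.W)) = 1 := by
      intro R R' μ hμ hR hR' _ _ hRz hRz'
      have := hR.isIrreducible_s16
      have := hR'.isIrreducible_s16
      have := hR.1
      have := hR'.1
      have horth := Representation.char_orthonormal R'.ρ R.ρ
      rw [CRep.sum_character_mul_character_inv hμ hz hconj hRz' hRz, hZcard] at horth
      have hne : (Nat.card E : ℂ)⁻¹ * ((4 : ℕ) * (finrank ℂ R'.W * finrank ℂ R.W)) ≠ 0 := by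
        have h1 : (finrank ℂ R.W : ℂ) ≠ 0 := Nat.cast_ne_zero.2 finrank_pos.ne'
        have h2 : (finrank ℂ R'.W : ℂ) ≠ 0 := Nat.cast_ne_zero.2 finrank_pos.ne'
        exact mul_ne_zero (inv_ne_zero hcardC) (mul_ne_zero (by norm_num) (mul_ne_zero h2 h1))
      split_ifs at horth with h
      · refine ⟨h, ?_⟩
        rw [← horth]
        push_cast
        ring
      · exact absurd horth hne
    intro R R' μ hμ hR hR' _ _ hRz hRz'
    obtain ⟨⟨φ⟩, -⟩ := hiso R R' μ hμ hR hR' ‹_› ‹_› hRz hRz'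
    obtain ⟨-, hd⟩ := hiso R R μ hμ hR hR ‹_› ‹_› hRz hRz
    refine ⟨⟨φ.toLinearEquiv, fun e w ↦ ?_⟩, ?_⟩
    · exact φ.toIntertwiningMap.isIntertwining _ _ e w
    · rw [inv_mul_eq_one₀ hcardC, hcard] at hd
      have hd' : 2 ^ (2 * m + 2) = 4 * (finrank ℂ R.W * finrank ℂ R.W) := by exact_mod_cast hd
      have : (finrank ℂ R.W) ^ 2 = (2 ^ m) ^ 2 := by
        rw [pow_add, pow_mul'] at hd'
        linarith
      exact Nat.pow_left_injective two_ne_zero this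
  have hI : Complex.I ^ 2 = -1 := Complex.I_sq
  have hI' : (-Complex.I) ^ 2 = -1 := by rw [neg_sq, Complex.I_sq]
  obtain ⟨R₁, hf₁, hi₁, hz₁⟩ :=
    CRep.exists_irreducible_of_orderOf_eq_four hzc hord Complex.I_pow_four
  obtain ⟨R₂, hf₂, hi₂, hz₂⟩ := CRep.exists_irreducible_of_orderOf_eq_four hzc hord
    (μ := -Complex.I) (by rw [neg_pow, Complex.I_pow_four]; norm_num)
  have hn₁ := hi₁.1
  have hn₂ := hi₂.1
  refine ⟨R₁, R₂, hf₁, hf₂, hi₁, hi₂, CRep.injective_of_smul hI hz hord hconj hz₁,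
    CRep.injective_of_smul hI' hz hord hconj hz₂, (hpair R₁ R₁ _ hI hi₁ hi₁ hf₁ hf₁ hz₁ hz₁).2,
    (hpair R₂ R₂ _ hI' hi₂ hi₂ hf₂ hf₂ hz₂ hz₂).2, hz₁, hz₂, ?_, ?_⟩
  · rintro ⟨φ, hφ⟩
    obtain ⟨w, hw⟩ := exists_ne (0 : R₁.W)
    have h := hφ z w
    rw [hz₁, hz₂, map_smul, neg_smul] at h
    exact (smul_eq_zero.1 (eq_zero_of_eq_neg_self h)).elim Complex.I_ne_zero
      fun h ↦ hw (φ.map_eq_zero_iff.1 h)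
  · intro R hf hi hinj
    obtain ⟨μ, hμ⟩ := hi.exists_smul hzc
    have hn := hi.1
    have hμ4 : μ ^ 4 = 1 := by
      obtain ⟨w, hw⟩ := exists_ne (0 : R.W)
      have h := CRep.pow_apply_of_smul hμ 4
      rw [← hord, pow_orderOf_eq_one, hord, map_one] at h
      have h0 : (μ ^ 4 - 1) • w = 0 := by
        rw [sub_smul, one_smul, sub_eq_zero]
        simpa using (LinearMap.congr_fun h w).symm
      exact sub_eq_zero.1 ((smul_eq_zero.1 h0).resolve_right hw)
    have hμ2 : μ ^ 2 ≠ 1 := by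
      intro h
      have h1 : R.ρ (z ^ 2) = R.ρ 1 := by
        rw [CRep.pow_apply_of_smul hμ, h, one_smul, map_one]
        rfl
      exact pow_ne_one_of_lt_orderOf two_ne_zero (by rw [hord]; norm_num) (hinj h1)
    have hsq : μ ^ 2 = -1 := by
      have : (μ ^ 2 - 1) * (μ ^ 2 + 1) = 0 := by linear_combination hμ4
      exact eq_neg_of_add_eq_zero_left
        ((mul_eq_zero.1 this).resolve_left (sub_ne_zero.2 hμ2))
    rcases sq_eq_sq_iff_eq_or_eq_neg.1 (hsq.trans hI.symm) with rfl | rfl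
    · exact .inl (hpair R R₁ _ hI hi hi₁ hf hf₁ hμ hz₁).1
    · exact .inr (hpair R R₂ _ hI' hi hi₂ hf hf₂ hμ hz₂).1
end
end

section
/- Let G be a finite group and H a subgroup such that the left-multiplication action of G on the coset space G/H is 2-transitive (equivalently, G = H ∪ HtH for some t ∈ G \ H). Let λ : H → ℂˣ be a group homomorphism, regarded as a one-dimensional complex representation ℂ_λ of H. Then the induced ℂ[G]-module ℂ[G] ⊗_{ℂ[H]} ℂ_λ has endomorphism algebra of ℂ-dimension at most 2; consequently it is the direct sum of at most two irreducible ℂ[G]-modules. -/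
open Module

noncomputable section

variable (G : Type) [Group G] (H : Subgroup G) (lam : H →* ℂˣ)

/-- A concrete model for the induced module `ℂ[G] ⊗_{ℂ[H]} ℂ_λ`: the space of
functions `f : G → ℂ` with `f (h * g) = λ h * f g` for `h ∈ H`, on which `G`
acts by right translation. -/
def indSubmodule : Submodule ℂ (G → ℂ) where
  carrier := {f | ∀ (h : H) (g : G), f ((h : G) * g) = (lam h : ℂ) * f g}
  zero_mem' := by intro h g; simp
  add_mem' := by
    intro a b ha hb h g
    simp only [Pi.add_apply, ha h g, hb h g, mul_add]
  smul_mem' := by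
    intro c f hf h g
    simp only [Pi.smul_apply, hf h g, smul_eq_mul]
    ring

/-- Right translation by `g` as a linear endomorphism of `G → ℂ`. -/
def rTrans (g : G) : (G → ℂ) →ₗ[ℂ] (G → ℂ) where
  toFun f := fun x => f (x * g)
  map_add' _ _ := rfl
  map_smul' _ _ := rfl

/-- The action of `g ∈ G` on the induced module. -/
def indAction (g : G) :
    indSubmodule G H lam →ₗ[ℂ] indSubmodule G H lam :=
  LinearMap.restrict (rTrans G g)
    (fun f hf h x => by simpa [rTrans, mul_assoc] using hf h (x * g))

/-- `T` is an endomorphism of the induced module as a `ℂ[G]`-module. -/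
def IsGEndo (T : indSubmodule G H lam →ₗ[ℂ] indSubmodule G H lam) : Prop :=
  ∀ (g : G) (f : indSubmodule G H lam),
    T (indAction G H lam g f) = indAction G H lam g (T f)

/-- A submodule of the induced module is `G`-invariant. -/
def IsGInvariant (W : Submodule ℂ (indSubmodule G H lam)) : Prop :=
  ∀ g : G, W.map (indAction G H lam g) ≤ W

variable {G H lam}

@[simp]
lemma coe_indAction_apply (g x : G) (f : indSubmodule G H lam) :
    (indAction G H lam g f : G → ℂ) x = (f : G → ℂ) (x * g) := rfl

lemma indSubmodule_apply_mul_left (f : indSubmodule G H lam) {h : G} (hh : h ∈ H) (g : G) :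
    (f : G → ℂ) (h * g) = (lam ⟨h, hh⟩ : ℂ) * (f : G → ℂ) g :=
  f.2 ⟨h, hh⟩ g

variable (G H lam)

/-- The induced module as a representation of `G`. -/
def indRepresentation : Representation ℂ G (indSubmodule G H lam) where
  toFun := indAction G H lam
  map_one' := by ext f x; simp
  map_mul' a b := by ext f x; simp [mul_assoc]

open Classical in
/-- The generator of the induced module: `λ` extended by zero outside `H`. -/
def indGenerator : indSubmodule G H lam :=
  ⟨fun g => if hg : g ∈ H then (lam ⟨g, hg⟩ : ℂ) else 0, by
    intro h g
    by_cases hg : g ∈ H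
    · have hhg : (h : G) * g ∈ H := H.mul_mem h.2 hg
      have : (⟨(h : G) * g, hhg⟩ : H) = h * ⟨g, hg⟩ := rfl
      simp only [hg, hhg, dite_true, this, map_mul, Units.val_mul]
    · have hhg : (h : G) * g ∉ H := fun h' => hg ((H.mul_mem_cancel_left h.2).1 h')
      simp [hg, hhg]⟩

variable {G H lam}

lemma indGenerator_apply_of_mem {g : G} (hg : g ∈ H) :
    (indGenerator G H lam : G → ℂ) g = (lam ⟨g, hg⟩ : ℂ) := by
  simp [indGenerator, hg]

lemma indGenerator_apply_of_notMem {g : G} (hg : g ∉ H) :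
    (indGenerator G H lam : G → ℂ) g = 0 := by
  simp [indGenerator, hg]

lemma indAction_indGenerator {h : G} (hh : h ∈ H) :
    indAction G H lam h (indGenerator G H lam) =
      (lam ⟨h, hh⟩ : ℂ) • indGenerator G H lam := by
  ext x
  by_cases hx : x ∈ H
  · have hxh : x * h ∈ H := H.mul_mem hx hh
    have : (⟨x * h, hxh⟩ : H) = ⟨x, hx⟩ * ⟨h, hh⟩ := rfl
    rw [coe_indAction_apply, indGenerator_apply_of_mem hxh, this, map_mul, Units.val_mul,
      mul_comm, Submodule.coe_smul, Pi.smul_apply, indGenerator_apply_of_mem hx, smul_eq_mul]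
  · have hxh : x * h ∉ H := fun h' => hx ((H.mul_mem_cancel_right hh).1 h')
    simp [indGenerator_apply_of_notMem hx, indGenerator_apply_of_notMem hxh]

/-- The translates of `indGenerator` span the induced module. -/
lemma sum_smul_indAction_indGenerator [Fintype G] (f : indSubmodule G H lam) :
    ∑ g : G, (f : G → ℂ) g • indAction G H lam g⁻¹ (indGenerator G H lam) =
      (Nat.card H : ℂ) • f := by
  classical
  ext x
  have key : ∀ g : G, (f : G → ℂ) g * (indGenerator G H lam : G → ℂ) (x * g⁻¹) =
      if x * g⁻¹ ∈ H then (f : G → ℂ) x else 0 := by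
    intro g
    split_ifs with h
    · rw [indGenerator_apply_of_mem h, mul_comm, ← indSubmodule_apply_mul_left]
      simp
    · simp [indGenerator_apply_of_notMem h]
  simp only [AddSubmonoidClass.coe_finsetSum, Finset.sum_apply, Submodule.coe_smul,
    Pi.smul_apply, smul_eq_mul, coe_indAction_apply, key]
  have e : ∑ g : G, (if x * g⁻¹ ∈ H then (f : G → ℂ) x else 0) =
      ∑ g : G, (if g ∈ H then (f : G → ℂ) x else 0) :=
    Fintype.sum_equiv ((Equiv.inv G).trans (Equiv.mulLeft x)) _ _ fun g => by simp
  rw [e, ← Finset.sum_filter, Finset.sum_const, nsmul_eq_mul, Nat.card_eq_fintype_card,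
    Fintype.card_subtype]

/-- An endomorphism of the induced module is determined by its value on the generator. -/
lemma IsGEndo.eq_zero [Finite G] {T : indSubmodule G H lam →ₗ[ℂ] indSubmodule G H lam}
    (hT : IsGEndo G H lam T) (h : T (indGenerator G H lam) = 0) : T = 0 := by
  have := Fintype.ofFinite G
  refine LinearMap.ext fun f => ?_
  have hs := congrArg T (sum_smul_indAction_indGenerator f)
  have hz : ∀ g : G, T (indAction G H lam g (indGenerator G H lam)) = 0 := fun g => by
    rw [hT, h, map_zero]
  simp only [map_sum, map_smul, hz, smul_zero, Finset.sum_const_zero] at hs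
  exact (smul_eq_zero.1 hs.symm).resolve_left (Nat.cast_ne_zero.2 Nat.card_pos.ne')

/-- If `G = H ∪ HtH`, the image of the generator under an endomorphism is determined by its
values at `1` and `t`. -/
lemma IsGEndo.eq_zero_of_apply [Finite G]
    {T : indSubmodule G H lam →ₗ[ℂ] indSubmodule G H lam} (hT : IsGEndo G H lam T) {t : G}
    (ht : ∀ g : G, g ∈ H ∨ ∃ h ∈ H, ∃ k ∈ H, g = h * (t * k))
    (h1 : (T (indGenerator G H lam) : G → ℂ) 1 = 0)
    (h2 : (T (indGenerator G H lam) : G → ℂ) t = 0) : T = 0 := by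
  refine hT.eq_zero (Subtype.ext (funext fun g => ?_))
  rcases ht g with hg | ⟨h, hh, k, hk, rfl⟩
  · rw [← mul_one g, indSubmodule_apply_mul_left _ hg, h1]
    simp
  · rw [indSubmodule_apply_mul_left _ hh, ← coe_indAction_apply, ← hT,
      indAction_indGenerator hk]
    simp [h2]

lemma exists_double_coset_of_two_transitive
    (h2t : ∀ x₁ x₂ y₁ y₂ : G ⧸ H, x₁ ≠ x₂ → y₁ ≠ y₂ →
      ∃ g : G, g • x₁ = y₁ ∧ g • x₂ = y₂) :
    ∃ t : G, ∀ g : G, g ∈ H ∨ ∃ h ∈ H, ∃ k ∈ H, g = h * (t * k) := by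
  by_cases hH : ∀ g : G, g ∈ H
  · exact ⟨1, fun g => Or.inl (hH g)⟩
  push Not at hH
  obtain ⟨t, ht⟩ := hH
  refine ⟨t, fun g => or_iff_not_imp_left.2 fun hg => ?_⟩
  have hne : ∀ x : G, x ∉ H → ((1 : G) : G ⧸ H) ≠ (x : G ⧸ H) := fun x hx h =>
    hx (by simpa using QuotientGroup.eq.1 h)
  obtain ⟨a, ha1, ha2⟩ := h2t _ _ _ _ (hne t ht) (hne g hg)
  rw [MulAction.Quotient.smul_coe, QuotientGroup.eq] at ha1 ha2
  exact ⟨a, by simpa using ha1, (a * t)⁻¹ * g, ha2, by simp [mul_assoc]⟩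

lemma IsGEndo.add {S T : indSubmodule G H lam →ₗ[ℂ] indSubmodule G H lam}
    (hS : IsGEndo G H lam S) (hT : IsGEndo G H lam T) : IsGEndo G H lam (S + T) :=
  fun g f => by simp [hS g f, hT g f]

lemma IsGEndo.smul {T : indSubmodule G H lam →ₗ[ℂ] indSubmodule G H lam} (c : ℂ)
    (hT : IsGEndo G H lam T) : IsGEndo G H lam (c • T) :=
  fun g f => by simp [hT g f]

lemma isGEndo_id : IsGEndo G H lam LinearMap.id := fun _ _ => rfl

/-- The projection along an invariant complement is an endomorphism of the induced module. -/
lemma isGEndo_projection {U U' : Submodule ℂ (indSubmodule G H lam)}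
    (hU : IsGInvariant G H lam U) (hU' : IsGInvariant G H lam U') (hc : IsCompl U U') :
    IsGEndo G H lam (U.projection U' hc) := by
  intro g f
  have h1 : indAction G H lam g (U.projection U' hc f) ∈ U :=
    hU g (Submodule.mem_map_of_mem (Submodule.projection_apply_mem hc f))
  have h2 : indAction G H lam g (f - U.projection U' hc f) ∈ U' :=
    hU' g (Submodule.mem_map_of_mem (Submodule.sub_projection_mem hc f))
  have h3 := (Submodule.projection_apply_eq_zero_iff hc).2 h2
  rw [map_sub, map_sub, sub_eq_zero] at h3
  rw [h3, Submodule.projection_apply_of_mem_left hc h1]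

/-- Maschke's theorem for the induced module. -/
lemma IsGInvariant.exists_isCompl [Finite G] {U : Submodule ℂ (indSubmodule G H lam)}
    (hU : IsGInvariant G H lam U) :
    ∃ U' : Submodule ℂ (indSubmodule G H lam), IsGInvariant G H lam U' ∧ IsCompl U U' := by
  have : NeZero (Nat.card G : ℂ) := ⟨Nat.cast_ne_zero.2 Nat.card_pos.ne'⟩
  let σ : Subrepresentation (indRepresentation G H lam) :=
    ⟨U, fun g v hv => hU g (Submodule.mem_map_of_mem hv)⟩
  have hss : (indRepresentation G H lam).IsSemisimpleRepresentation := inferInstance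
  obtain ⟨τ, hτ⟩ := hss.exists_isCompl σ
  refine ⟨τ.toSubmodule, fun g => Submodule.map_le_iff_le_comap.2 fun v hv =>
    τ.apply_mem_toSubmodule g hv, ?_⟩
  exact isCompl_iff.2
    ⟨disjoint_iff.2 (congrArg Subrepresentation.toSubmodule hτ.inf_eq_bot),
      codisjoint_iff.2 (congrArg Subrepresentation.toSubmodule hτ.sup_eq_top)⟩

/-- If any three endomorphisms are linearly dependent, then a proper nonzero invariant direct
summand is irreducible. -/
lemma IsGInvariant.eq_bot_or_eq_of_le [Finite G]
    (hdim : ∀ T₁ T₂ T₃ : indSubmodule G H lam →ₗ[ℂ] indSubmodule G H lam,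
      IsGEndo G H lam T₁ → IsGEndo G H lam T₂ → IsGEndo G H lam T₃ →
      ∃ c₁ c₂ c₃ : ℂ, ¬(c₁ = 0 ∧ c₂ = 0 ∧ c₃ = 0) ∧
        c₁ • T₁ + c₂ • T₂ + c₃ • T₃ = 0)
    {W W' U : Submodule ℂ (indSubmodule G H lam)} (hW : IsGInvariant G H lam W)
    (hW' : IsGInvariant G H lam W') (hc : IsCompl W W') (hne : W' ≠ ⊥) (hUW : U ≤ W)
    (hU : IsGInvariant G H lam U) : U = ⊥ ∨ U = W := by
  by_contra! hcon
  obtain ⟨hU0, hUne⟩ := hcon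
  obtain ⟨U', hU', hcU⟩ := hU.exists_isCompl
  have hinf : U' ⊓ W ≠ ⊥ := fun h => hUne <| by
    have := sup_inf_assoc_of_le U' hUW
    rwa [hcU.sup_eq_top, top_inf_eq, h, sup_bot_eq, eq_comm] at this
  obtain ⟨u, hu, hu0⟩ := Submodule.exists_mem_ne_zero_of_ne_bot hU0
  obtain ⟨v, ⟨hvU', hvW⟩, hv0⟩ := Submodule.exists_mem_ne_zero_of_ne_bot hinf
  obtain ⟨w, hw, hw0⟩ := Submodule.exists_mem_ne_zero_of_ne_bot hne
  obtain ⟨c₁, c₂, c₃, hc0, hsum⟩ := hdim _ _ _ isGEndo_id (isGEndo_projection hW hW' hc)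
    (isGEndo_projection hU hU' hcU)
  have eu := LinearMap.congr_fun hsum u
  have ev := LinearMap.congr_fun hsum v
  have ew := LinearMap.congr_fun hsum w
  simp only [LinearMap.add_apply, LinearMap.smul_apply, LinearMap.id_apply,
    LinearMap.zero_apply] at eu ev ew
  rw [Submodule.projection_apply_of_mem_left hc (hUW hu),
    Submodule.projection_apply_of_mem_left hcU hu, ← add_smul, ← add_smul] at eu
  rw [Submodule.projection_apply_of_mem_left hc hvW,
    (Submodule.projection_apply_eq_zero_iff hcU).2 hvU', smul_zero, add_zero, ← add_smul] at ev
  have e1 := (smul_eq_zero.1 eu).resolve_right hu0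
  have e2 := (smul_eq_zero.1 ev).resolve_right hv0
  have h3 : c₃ = 0 := by rwa [e2, zero_add] at e1
  rw [(Submodule.projection_apply_eq_zero_iff hc).2 hw, h3, smul_zero, zero_smul, add_zero,
    add_zero] at ew
  have h1 := (smul_eq_zero.1 ew).resolve_right hw0
  exact hc0 ⟨h1, by rwa [h1, zero_add] at e2, h3⟩

lemma exists_smul_add_smul_add_smul_eq_zero [Finite G]
    (h2t : ∀ x₁ x₂ y₁ y₂ : G ⧸ H, x₁ ≠ x₂ → y₁ ≠ y₂ →
      ∃ g : G, g • x₁ = y₁ ∧ g • x₂ = y₂)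
    (T₁ T₂ T₃ : indSubmodule G H lam →ₗ[ℂ] indSubmodule G H lam)
    (h₁ : IsGEndo G H lam T₁) (h₂ : IsGEndo G H lam T₂) (h₃ : IsGEndo G H lam T₃) :
    ∃ c₁ c₂ c₃ : ℂ, ¬(c₁ = 0 ∧ c₂ = 0 ∧ c₃ = 0) ∧ c₁ • T₁ + c₂ • T₂ + c₃ • T₃ = 0 := by
  obtain ⟨t, ht⟩ := exists_double_coset_of_two_transitive h2t
  let φ (T : indSubmodule G H lam →ₗ[ℂ] indSubmodule G H lam) : Fin 2 → ℂ :=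
    ![(T (indGenerator G H lam) : G → ℂ) 1, (T (indGenerator G H lam) : G → ℂ) t]
  have hdep : ¬ LinearIndependent ℂ ![φ T₁, φ T₂, φ T₃] := fun h => by
    simpa using h.fintype_card_le_finrank
  obtain ⟨c, hsum, i, hi⟩ := Fintype.not_linearIndependent_iff.1 hdep
  refine ⟨c 0, c 1, c 2, fun ⟨h0, h1, h2⟩ => hi (by fin_cases i <;> assumption), ?_⟩
  refine (((h₁.smul (c 0)).add (h₂.smul (c 1))).add (h₃.smul (c 2))).eq_zero_of_apply ht ?_ ?_
  · simpa [Fin.sum_univ_three, φ] using congrFun hsum 0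
  · simpa [Fin.sum_univ_three, φ] using congrFun hsum 1

variable (G H lam)

theorem induced_module_from_two_transitive
    [Finite G]
    (h2t : ∀ x₁ x₂ y₁ y₂ : G ⧸ H, x₁ ≠ x₂ → y₁ ≠ y₂ →
      ∃ g : G, g • x₁ = y₁ ∧ g • x₂ = y₂) :
    -- the endomorphism algebra has dimension at most 2
    (∀ T₁ T₂ T₃ : indSubmodule G H lam →ₗ[ℂ] indSubmodule G H lam,
      IsGEndo G H lam T₁ → IsGEndo G H lam T₂ → IsGEndo G H lam T₃ →
      ∃ c₁ c₂ c₃ : ℂ, ¬(c₁ = 0 ∧ c₂ = 0 ∧ c₃ = 0) ∧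
        c₁ • T₁ + c₂ • T₂ + c₃ • T₃ = 0) ∧
    -- consequently the induced module is the direct sum of at most two irreducibles
    (∃ W₁ W₂ : Submodule ℂ (indSubmodule G H lam),
      IsGInvariant G H lam W₁ ∧ IsGInvariant G H lam W₂ ∧ IsCompl W₁ W₂ ∧
      (W₁ = ⊥ ∨ (W₁ ≠ ⊥ ∧ ∀ W : Submodule ℂ (indSubmodule G H lam),
        W ≤ W₁ → IsGInvariant G H lam W → W = ⊥ ∨ W = W₁)) ∧
      (W₂ = ⊥ ∨ (W₂ ≠ ⊥ ∧ ∀ W : Submodule ℂ (indSubmodule G H lam),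
        W ≤ W₂ → IsGInvariant G H lam W → W = ⊥ ∨ W = W₂))) := by
  have hdim := exists_smul_add_smul_add_smul_eq_zero (lam := lam) h2t
  refine ⟨hdim, ?_⟩
  have hbot : IsGInvariant G H lam ⊥ := fun g => by simp
  have htop : IsGInvariant G H lam ⊤ := fun g => le_top
  by_cases hirr : ∀ W : Submodule ℂ (indSubmodule G H lam),
      IsGInvariant G H lam W → W = ⊥ ∨ W = ⊤
  · refine ⟨⊤, ⊥, htop, hbot, isCompl_top_bot, ?_, Or.inl rfl⟩
    exact or_iff_not_imp_left.2 fun h => ⟨h, fun W _ hW => hirr W hW⟩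
  · push Not at hirr
    obtain ⟨W, hW, hW0, hW1⟩ := hirr
    obtain ⟨W', hW', hc⟩ := hW.exists_isCompl
    have hW'0 : W' ≠ ⊥ := fun h => hW1 (by simpa [h] using hc.sup_eq_top)
    exact ⟨W, W', hW, hW', hc,
      Or.inr ⟨hW0, fun U hUW hU => hW.eq_bot_or_eq_of_le hdim hW' hc hW'0 hUW hU⟩,
      Or.inr ⟨hW'0, fun U hUW hU => hW'.eq_bot_or_eq_of_le hdim hW hc.symm hW0 hUW hU⟩⟩
end
end

section
/- Let S be the alternating group A₇ and let U be a 5-dimensional F₂[S]-module whose fixed-point submodule C_U(S) = {u ∈ U : u·s = u for all s ∈ S} is one-dimensional. Then C_U(S) has an S-invariant complement in U: there is an S-submodule W of U with U = C_U(S) ⊕ W. -/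
open Module

noncomputable section

/-- For an endomorphism of order dividing three in characteristic two, the fixed space and the
commutator space meet trivially. -/
theorem disjoint_ker_range_sub_one {V : Type*} [AddCommGroup V] [Module (ZMod 2) V]
    {f : End (ZMod 2) V} (hf : f ^ 3 = 1) :
    Disjoint (LinearMap.ker (f - 1)) (LinearMap.range (f - 1)) := by
  rw [Submodule.disjoint_def]
  rintro _ hx ⟨y, rfl⟩
  have h3 : f (f (f y)) = y := by simpa [pow_succ] using LinearMap.congr_fun hf y
  have h1 : f (f y - y) = f y - y := by simpa [sub_eq_zero] using hx
  have h2 : f (f y) = y := by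
    rw [map_sub, sub_eq_iff_eq_add, ← ZModModule.sub_eq_add _ (f y)] at h1
    simpa [sub_sub, ZModModule.neg_eq_self, ZModModule.add_self] using h1
  simpa [h2, sub_eq_zero] using h3

/-- An endomorphism of order dividing three in characteristic two has fixed space of even
codimension. -/
theorem finrank_ker_sub_one_mod_two {V : Type*} [AddCommGroup V] [Module (ZMod 2) V]
    [Module.Finite (ZMod 2) V] {f : End (ZMod 2) V} (hf : f ^ 3 = 1) :
    finrank (ZMod 2) V % 2 = finrank (ZMod 2) (LinearMap.ker (f - 1)) % 2 := by
  classical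
  have : Finite V := Module.finite_of_finite (ZMod 2)
  have := Fintype.ofFinite V
  have hpow : (show Function.End V from ⇑f) ^ 3 ^ 1 = 1 := by
    funext x
    have := LinearMap.congr_fun hf x
    simp only [pow_succ, pow_zero, one_mul, End.mul_apply, End.one_apply] at this
    exact this
  have hcard := Equiv.Perm.card_fixedPoints_modEq (p := 3) hpow
  have hfix : Fintype.card (Function.fixedPoints f) = Nat.card (LinearMap.ker (f - 1)) := by
    rw [Fintype.card_eq_nat_card]
    exact Nat.card_congr (Equiv.subtypeEquivRight fun x ↦ by
      simp [Function.mem_fixedPoints, Function.IsFixedPt, sub_eq_zero])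
  have hmod : 2 ^ finrank (ZMod 2) V ≡ 2 ^ finrank (ZMod 2) (LinearMap.ker (f - 1)) [MOD 3] := by
    have h1 := Module.natCard_eq_pow_finrank (K := ZMod 2) (V := V)
    have h2 := Module.natCard_eq_pow_finrank (K := ZMod 2) (V := LinearMap.ker (f - 1))
    rw [Nat.card_zmod] at h1 h2
    rw [← h1, ← h2, ← hfix, Nat.card_eq_fintype_card]
    exact hcard
  have two_pow (n : ℕ) : 2 ^ n % 3 = if n % 2 = 0 then 1 else 2 := by
    induction n with
    | zero => rfl
    | succ n ih => rw [pow_succ, Nat.mul_mod, ih]; split_ifs <;> omega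
  rw [Nat.ModEq, two_pow, two_pow] at hmod
  split_ifs at hmod <;> omega

/-- Two disjoint 3-cycles in `A₇` have centralizers that together generate `A₇`. -/
theorem exists_commute_isThreeCycle_centralizers_generate :
    ∃ s t : alternatingGroup (Fin 7), (s : Equiv.Perm (Fin 7)).IsThreeCycle ∧
      (t : Equiv.Perm (Fin 7)).IsThreeCycle ∧ Commute s t ∧
      ∀ H : Subgroup (alternatingGroup (Fin 7)),
        (∀ g, Commute g s → g ∈ H) → (∀ g, Commute g t → g ∈ H) → H = ⊤ := by
  let cyc (i j k : Fin 7) : Equiv.Perm (Fin 7) := Equiv.swap i j * Equiv.swap i k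
  have hcyc {i j k : Fin 7} (hij : i ≠ j) (hik : i ≠ k) (hjk : j ≠ k) :
      (cyc i j k).IsThreeCycle := Equiv.Perm.isThreeCycle_swap_mul_swap_same hij hik hjk
  have hs : (cyc 0 1 2).IsThreeCycle := hcyc (by decide) (by decide) (by decide)
  have ht : (cyc 3 4 5).IsThreeCycle := hcyc (by decide) (by decide) (by decide)
  have ha : (cyc 3 4 6).IsThreeCycle := hcyc (by decide) (by decide) (by decide)
  have hb : (cyc 0 1 6).IsThreeCycle := hcyc (by decide) (by decide) (by decide)
  have hst : cyc 0 1 2 * cyc 3 4 5 = cyc 3 4 5 * cyc 0 1 2 := by decide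
  refine ⟨⟨_, hs.mem_alternatingGroup⟩, ⟨_, ht.mem_alternatingGroup⟩, hs, ht,
    Subtype.ext hst, fun H h₁ h₂ ↦ ?_⟩
  let G := H.map (alternatingGroup (Fin 7)).subtype
  have mem {g : Equiv.Perm (Fin 7)} (hg : g.IsThreeCycle)
      (h : g * cyc 0 1 2 = cyc 0 1 2 * g ∨ g * cyc 3 4 5 = cyc 3 4 5 * g) : g ∈ G :=
    ⟨⟨g, hg.mem_alternatingGroup⟩,
      h.elim (fun h ↦ h₁ _ (Subtype.ext h)) (fun h ↦ h₂ _ (Subtype.ext h)), rfl⟩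
  have hsG : cyc 0 1 2 ∈ G := mem hs (by decide)
  have htG : cyc 3 4 5 ∈ G := mem ht (by decide)
  have haG : cyc 3 4 6 ∈ G := mem ha (by decide)
  have hbG : cyc 0 1 6 ∈ G := mem hb (by decide)
  have orbit (x : Fin 7) : x ∈ MulAction.orbit G (0 : Fin 7) := by
    have step {g : Equiv.Perm (Fin 7)} (hg : g ∈ G) {y z : Fin 7}
        (hy : y ∈ MulAction.orbit G (0 : Fin 7)) (hz : g z = y) :
        z ∈ MulAction.orbit G (0 : Fin 7) := by
      have : (⟨g, hg⟩ : G) • z = y := hz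
      rw [← MulAction.orbit_eq_iff] at hy ⊢
      rw [← hy, ← this, MulAction.orbit_smul]
    have h0 := MulAction.mem_orbit_self (M := G) (0 : Fin 7)
    have h1 := step hsG h0 (show cyc 0 1 2 1 = 0 by decide)
    have h2 := step hsG h1 (show cyc 0 1 2 2 = 1 by decide)
    have h6 := step hbG h1 (show cyc 0 1 6 6 = 1 by decide)
    have h3 := step haG h6 (show cyc 3 4 6 3 = 6 by decide)
    have h4 := step htG h3 (show cyc 3 4 5 4 = 3 by decide)
    have h5 := step htG h4 (show cyc 3 4 5 5 = 4 by decide)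
    fin_cases x <;> assumption
  have : MulAction.IsPretransitive G (Fin 7) :=
    (MulAction.isPretransitive_iff_orbit_eq_univ (0 : Fin 7)).2 (Set.eq_univ_of_forall orbit)
  have hG := Equiv.Perm.alternatingGroup_le_of_isPreprimitive_of_isThreeCycle_mem
    (MulAction.IsPreprimitive.of_prime_card (by norm_num)) hs hsG
  refine (Subgroup.eq_top_iff' H).2 fun g ↦ ?_
  obtain ⟨h, hh, hhg⟩ := hG g.2
  exact Subtype.ext hhg ▸ hh

theorem alternatingGroup_seven_hom_trivial_of_not_injective {M : Type*} [MulOneClass M]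
    (φ : alternatingGroup (Fin 7) →* M) (hφ : ¬ Function.Injective φ)
    (g : alternatingGroup (Fin 7)) : φ g = 1 := by
  have : IsSimpleGroup (alternatingGroup (Fin 7)) := alternatingGroup.isSimpleGroup (by simp)
  rw [← MonoidHom.ker_eq_bot_iff] at hφ
  have htop := (MonoidHom.normal_ker φ).eq_bot_or_eq_top.resolve_left hφ
  exact MonoidHom.mem_ker.1 (htop ▸ Subgroup.mem_top g)

/-- Over the field with two elements, `A₇` acts trivially on every invariant subspace of
dimension at most three, as its order exceeds the number of endomorphisms of that subspace. -/
theorem alternatingGroup_seven_fixes_of_finrank_le_three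
    {U : Type*} [AddCommGroup U] [Module (ZMod 2) U] [Module.Finite (ZMod 2) U]
    (r : Representation (ZMod 2) (alternatingGroup (Fin 7)) U) {M : Submodule (ZMod 2) U}
    (hM : ∀ g, ∀ x ∈ M, r g x ∈ M) (hdim : finrank (ZMod 2) M ≤ 3)
    (g : alternatingGroup (Fin 7)) {x : U} (hx : x ∈ M) : r g x = x := by
  let φ : alternatingGroup (Fin 7) →* End (ZMod 2) M :=
    { toFun g := (r g).restrict (hM g)
      map_one' := by ext; simp
      map_mul' g h := by ext; simp }
  have hφ : ¬ Function.Injective φ := fun h ↦ by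
    have : Finite (End (ZMod 2) M) := Module.finite_of_finite (ZMod 2)
    have hle := Nat.card_le_card_of_injective φ h
    rw [Module.natCard_eq_pow_finrank (K := ZMod 2) (V := End (ZMod 2) M), Module.finrank_linearMap, Nat.card_zmod,
      nat_card_alternatingGroup, Nat.card_fin] at hle
    have hpow : 2 ^ (finrank (ZMod 2) M * finrank (ZMod 2) M) ≤ 2 ^ (3 * 3) :=
      Nat.pow_le_pow_right two_pos (Nat.mul_le_mul hdim hdim)
    exact absurd (hle.trans hpow) (by decide)
  have := LinearMap.congr_fun (alternatingGroup_seven_hom_trivial_of_not_injective φ hφ g) ⟨x, hx⟩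
  exact congrArg Subtype.val this

section Commuting

variable {k G V : Type*} [Field k] [Group G] [AddCommGroup V] [Module k V]
  (r : Representation k G V)

theorem map_mem_ker_sub_one_of_commute {g s : G} (h : Commute g s) {x : V}
    (hx : x ∈ LinearMap.ker (r s - 1)) : r g x ∈ LinearMap.ker (r s - 1) := by
  have hc := LinearMap.congr_fun (h.map r).eq x
  simp only [LinearMap.mem_ker, LinearMap.sub_apply, End.one_apply, sub_eq_zero,
    End.mul_apply] at *
  rw [← hc, hx]

theorem map_mem_range_sub_one_of_commute {g s : G} (h : Commute g s) {x : V}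
    (hx : x ∈ LinearMap.range (r s - 1)) : r g x ∈ LinearMap.range (r s - 1) := by
  obtain ⟨y, rfl⟩ := hx
  have hc := LinearMap.congr_fun (h.map r).eq y
  refine ⟨r g y, ?_⟩
  simp only [LinearMap.sub_apply, End.one_apply, End.mul_apply, map_sub] at *
  rw [hc]

/-- A subspace invariant under two centralizers is invariant under the group they generate. -/
theorem map_mem_of_centralizers_generate {s t : G}
    (hst : ∀ H : Subgroup G, (∀ g, Commute g s → g ∈ H) → (∀ g, Commute g t → g ∈ H) → H = ⊤)
    {M : Submodule k V} (hs : ∀ g, Commute g s → ∀ x ∈ M, r g x ∈ M)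
    (ht : ∀ g, Commute g t → ∀ x ∈ M, r g x ∈ M) (g : G) {x : V} (hx : x ∈ M) : r g x ∈ M := by
  let H : Subgroup G :=
    { carrier := {g | ∀ x, r g x ∈ M ↔ x ∈ M}
      one_mem' := by simp
      mul_mem' := fun {a b} ha hb x ↦ by
        rw [map_mul, End.mul_apply, ha, hb]
      inv_mem' := fun {a} ha x ↦ by
        rw [← ha, Representation.self_inv_apply] }
  have aux {u : G} (hu : ∀ g, Commute g u → ∀ x ∈ M, r g x ∈ M) (g : G) (hg : Commute g u) :
      g ∈ H := fun x ↦
    ⟨fun h ↦ by simpa using hu g⁻¹ hg.inv_left _ h, hu g hg x⟩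
  have htop := hst H (aux hs) (aux ht)
  have hg : g ∈ H := htop ▸ Subgroup.mem_top g
  exact (hg x).2 hx

theorem finrank_range_sub_one_eq_of_isConj {s t : G} (h : IsConj s t) :
    finrank k (LinearMap.range (r s - 1)) = finrank k (LinearMap.range (r t - 1)) := by
  obtain ⟨c, rfl⟩ := isConj_iff.1 h
  let e : V ≃ₗ[k] V := LinearEquiv.ofLinearMap (r c) (r c⁻¹)
    (by ext; simp) (by ext; simp)
  have hmap : (LinearMap.range (r s - 1)).map (e : V →ₗ[k] V) =
      LinearMap.range (r (c * s * c⁻¹) - 1) := by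
    have hcomp : (e : V →ₗ[k] V) ∘ₗ (r s - 1) = (r (c * s * c⁻¹) - 1) ∘ₗ (e : V →ₗ[k] V) := by
      ext x
      simp [e]
    rw [← LinearMap.range_comp, hcomp, LinearMap.range_comp_of_range_eq_top _ e.range]
  rw [← hmap, LinearEquiv.finrank_map_eq]

end Commuting

/-- A subspace of dimension two on which `f` acts without nonzero fixed vectors is irreducible. -/
theorem disjoint_or_le_of_finrank_eq_two {V : Type*} [AddCommGroup V] [Module (ZMod 2) V]
    [Module.Finite (ZMod 2) V] {f : End (ZMod 2) V} (hf : Function.Injective f)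
    {W N : Submodule (ZMod 2) V} (hW : finrank (ZMod 2) W = 2)
    (hfW : Disjoint (LinearMap.ker (f - 1)) W) (hinvW : ∀ x ∈ W, f x ∈ W)
    (hinvN : ∀ x ∈ N, f x ∈ N) : Disjoint W N ∨ W ≤ N := by
  by_contra! ⟨hdis, hle⟩
  have hlt : finrank (ZMod 2) ↥(W ⊓ N) < 2 :=
    (Submodule.finrank_lt_finrank_of_lt (inf_lt_left.2 hle)).trans_eq hW
  obtain ⟨x, hx, hx0⟩ := Submodule.exists_mem_ne_zero_of_ne_bot (mt disjoint_iff.2 hdis)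
  have hone : finrank (ZMod 2) ↥(W ⊓ N) = 1 := by
    have : finrank (ZMod 2) ↥(W ⊓ N) ≠ 0 := fun h ↦
      hdis (disjoint_iff.2 (Submodule.finrank_eq_zero.1 h))
    omega
  obtain ⟨c, hc⟩ := (finrank_eq_one_iff_of_nonzero' (⟨x, hx⟩ : ↥(W ⊓ N))
    (by simpa using hx0)).1 hone ⟨f x, hinvW x hx.1, hinvN x hx.2⟩
  replace hc : c • x = f x := congrArg Subtype.val hc
  have hfx : f x ≠ 0 := (map_ne_zero_iff f hf).2 hx0
  have hc1 : c = 1 := by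
    have hc0 : c ≠ 0 := by rintro rfl; exact hfx (by simpa using hc.symm)
    exact Fin.eq_one_of_ne_zero c hc0
  exact hx0 (Submodule.disjoint_def.1 hfW x (by simp [← hc, hc1]) hx.1)

theorem A7_fixed_points_have_invariant_complement
    (U : Type) [AddCommGroup U] [Module (ZMod 2) U] [Module.Finite (ZMod 2) U]
    (ρ : alternatingGroup (Fin 7) →* (U ≃ₗ[ZMod 2] U))
    -- `U` is 5-dimensional
    (hdim : finrank (ZMod 2) U = 5)
    -- `C` is the fixed-point submodule `C_U(S)`
    (C : Submodule (ZMod 2) U)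
    (hC : ∀ u : U, u ∈ C ↔ ∀ s : alternatingGroup (Fin 7), ρ s u = u)
    -- `C_U(S)` is one-dimensional
    (hCdim : finrank (ZMod 2) C = 1) :
    ∃ W : Submodule (ZMod 2) U,
      (∀ s : alternatingGroup (Fin 7), W.map (ρ s : U →ₗ[ZMod 2] U) ≤ W) ∧
      IsCompl C W := by
  obtain ⟨s, t, hs, ht, hst, hgen⟩ := exists_commute_isThreeCycle_centralizers_generate
  let r : Representation (ZMod 2) (alternatingGroup (Fin 7)) U :=
    LinearEquiv.automorphismGroup.toLinearMapMonoidHom.comp ρ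
  have hsmall {M : Submodule (ZMod 2) U} (hM : ∀ g, ∀ x ∈ M, r g x ∈ M)
      (hM3 : finrank (ZMod 2) M ≤ 3) : finrank (ZMod 2) M ≤ 1 :=
    hCdim ▸ Submodule.finrank_mono fun x hx ↦ (hC x).2 fun g ↦
      alternatingGroup_seven_fixes_of_finrank_le_three r hM hM3 g hx
  have hCker (g) : C ≤ LinearMap.ker (r g - 1) := fun x hx ↦
    sub_eq_zero.2 ((hC x).1 hx g)
  have hpow {g : alternatingGroup (Fin 7)} (hg : (g : Equiv.Perm (Fin 7)).IsThreeCycle) :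
      r g ^ 3 = 1 := by
    have : g ^ 3 = 1 := Subtype.ext (hg.orderOf ▸ pow_orderOf_eq_one (g : Equiv.Perm (Fin 7)))
    rw [← map_pow, this, map_one]
  have hdis_s := disjoint_ker_range_sub_one (hpow hs)
  have hdis_t := disjoint_ker_range_sub_one (hpow ht)
  have hodd := finrank_ker_sub_one_mod_two (hpow hs)
  have hsum_s := (r s - 1).finrank_range_add_finrank_ker
  have hsum_t := (r t - 1).finrank_range_add_finrank_ker
  have hconj := finrank_range_sub_one_eq_of_isConj r
    (alternatingGroup.isThreeCycle_isConj (by simp) hs ht)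
  have hker : 1 ≤ finrank (ZMod 2) (LinearMap.ker (r s - 1)) :=
    hCdim ▸ Submodule.finrank_mono (hCker s)
  have hrange_ne : finrank (ZMod 2) (LinearMap.range (r s - 1)) ≠ 0 := fun h ↦ by
    have hrs : r s = 1 :=
      sub_eq_zero.1 (LinearMap.range_eq_bot.1 (Submodule.finrank_eq_zero.1 h))
    have htriv := alternatingGroup_seven_hom_trivial_of_not_injective r fun hinj ↦ by
      have : s = 1 := hinj (hrs.trans (map_one r).symm)
      exact hs.ne_one (congrArg Subtype.val this)
    have hCtop : C = ⊤ := (Submodule.eq_top_iff').2 fun x ↦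
      (hC x).2 fun g ↦ LinearMap.congr_fun (htriv g) x
    rw [hCtop, finrank_top] at hCdim
    omega
  -- an equality of the two commutator spaces makes them invariant under the whole group
  have hinv (h : LinearMap.range (r t - 1) = LinearMap.range (r s - 1)) (g) :
      ∀ x ∈ LinearMap.range (r s - 1), r g x ∈ LinearMap.range (r s - 1) :=
    fun x ↦ map_mem_of_centralizers_generate r hgen
      (fun g hg x ↦ map_mem_range_sub_one_of_commute r hg)
      (h ▸ fun g hg x ↦ map_mem_range_sub_one_of_commute r hg) g
  have hfour : finrank (ZMod 2) (LinearMap.range (r s - 1)) = 4 := by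
    by_contra hne
    have htwo : finrank (ZMod 2) (LinearMap.range (r s - 1)) = 2 := by omega
    rcases disjoint_or_le_of_finrank_eq_two (r.apply_bijective s).injective htwo hdis_s
      (fun x ↦ map_mem_range_sub_one_of_commute r (Commute.refl s))
      (fun x ↦ map_mem_range_sub_one_of_commute r hst) with hdis | hle
    · -- here the fixed space of `s` is `C` plus the commutator space of `t`
      have hle : LinearMap.range (r t - 1) ≤ LinearMap.ker (r s - 1) := fun x hx ↦
        Submodule.disjoint_def.1 hdis _ ⟨x, rfl⟩
          (sub_mem (map_mem_range_sub_one_of_commute r hst hx) hx)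
      have heq : C ⊔ LinearMap.range (r t - 1) = LinearMap.ker (r s - 1) := by
        refine Submodule.eq_of_le_of_finrank_eq (sup_le (hCker s) hle) ?_
        have := Submodule.finrank_sup_add_finrank_inf_eq C (LinearMap.range (r t - 1))
        rw [disjoint_iff.1 (hdis_t.mono_left (hCker t)), finrank_bot] at this
        omega
      have := hsmall (M := LinearMap.ker (r s - 1)) (fun g x ↦
        map_mem_of_centralizers_generate r hgen
          (fun g hg x ↦ map_mem_ker_sub_one_of_commute r hg)
          (fun g hg x hx ↦ by
            rw [← heq] at hx ⊢
            obtain ⟨c, hc, y, hy, rfl⟩ := Submodule.mem_sup.1 hx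
            rw [map_add]
            exact add_mem (Submodule.mem_sup_left (((hC c).1 hc g).symm ▸ hc))
              (Submodule.mem_sup_right (map_mem_range_sub_one_of_commute r hg hy))) g) (by omega)
      omega
    · have := hsmall (hinv (Submodule.eq_of_le_of_finrank_eq hle hconj).symm) (by omega)
      omega
  have hcompl : IsCompl C (LinearMap.range (r s - 1)) :=
    (Submodule.isCompl_iff_disjoint _ _ (by omega)).2 (hdis_s.mono_left (hCker s))
  have hle : LinearMap.range (r t - 1) ≤ LinearMap.range (r s - 1) := by
    rintro _ ⟨x, rfl⟩
    obtain ⟨c, hc, y, hy, rfl⟩ := Submodule.mem_sup.1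
      (hcompl.sup_eq_top ▸ Submodule.mem_top : x ∈ C ⊔ LinearMap.range (r s - 1))
    rw [map_add, LinearMap.mem_ker.1 (hCker t hc), zero_add]
    exact sub_mem (map_mem_range_sub_one_of_commute r hst.symm hy) hy
  refine ⟨LinearMap.range (r s - 1), fun g ↦ ?_, hcompl⟩
  rintro _ ⟨x, hx, rfl⟩
  exact hinv (Submodule.eq_of_le_of_finrank_eq hle hconj.symm) g x hx
end
end
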